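/- arXiv:1504.06380 — 2 statements merged into one kernel-verified Lean document; each statement's English description precedes it below -/
import Mathlib

section
/- Let P₁ = Σ a¹_jk(x)∂²_{jk} and P₂ = Σ a²_jk(x)∂²_{jk} be uniformly elliptic second-order operators on an open set Ω ⊂ ℝ³ with coefficients in the Gevrey class G^s(Ω), s ≥ 1, and let a_β ∈ G^s(Ω) (|β| ≤ 3) be 7×7-matrix-valued. If U : Ω → ℝ⁷ is smooth and satisfies the elliptic system P₂P₁ U = Σ_{|β|≤3} a_β ∂^β U in Ω, then every component of U belongs to G^s(V) for every bounded open set V with closure contained in Ω. -/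
open MeasureTheory Metric Finset

noncomputable section

/-- `ℝ³` with the Euclidean norm. -/
abbrev E3 := EuclideanSpace ℝ (Fin 3)
/-- `ℝ⁷` with the Euclidean norm. -/
abbrev E7 := EuclideanSpace ℝ (Fin 7)

/-- The partial derivative `∂_i f`. -/
def pd (i : Fin 3) (f : E3 → ℝ) : E3 → ℝ :=
  fun x => fderiv ℝ f x (EuclideanSpace.single i 1)

/-- The multiindex partial derivative `∂^β f`. -/
def mpd (β : Fin 3 → ℕ) (f : E3 → ℝ) : E3 → ℝ :=
  (pd 0)^[β 0] ((pd 1)^[β 1] ((pd 2)^[β 2] f))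

/-- The length `|β|` of a multiindex. -/
def mdeg (β : Fin 3 → ℕ) : ℕ := β 0 + β 1 + β 2

/-- `f` belongs to the Gevrey class `G^s(Ω)`. -/
def GevreyOn (s : ℝ) (Ω : Set E3) (f : E3 → ℝ) : Prop :=
  ContDiffOn ℝ (⊤ : ℕ∞) f Ω ∧ ∃ c > 0, ∃ A > 0, ∀ β : Fin 3 → ℕ, ∀ x ∈ Ω,
    |mpd β f x| ≤ c * A ^ mdeg β * (Nat.factorial (mdeg β) : ℝ) ^ s

/-- The second-order operator `Σ_{j,k} a_jk(x) ∂²_{jk}` applied to a scalar function. -/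
def op2 (a : Fin 3 → Fin 3 → E3 → ℝ) (f : E3 → ℝ) : E3 → ℝ :=
  fun x => ∑ j, ∑ k, a j k x * pd j (pd k f) x

/-- Uniform (strong) ellipticity of `Σ_{j,k} a_jk(x) ∂²_{jk}` on `Ω`. -/
def UnifElliptic (a : Fin 3 → Fin 3 → E3 → ℝ) (Ω : Set E3) : Prop :=
  ∃ c0 > 0, ∀ x ∈ Ω, ∀ ξ : Fin 3 → ℝ,
    c0 * (∑ i, ξ i ^ 2) ≤ ∑ j, ∑ k, a j k x * ξ j * ξ k

/-- The coefficient matrix of the operator at a point. -/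
def coefMatrix (a : Fin 3 → Fin 3 → E3 → ℝ) (x : E3) : Matrix (Fin 3) (Fin 3) ℝ :=
  Matrix.of fun j k => a j k x

/-- `α > (λ₃ - λ₁)/λ₁` where `λ₁ ≤ λ₂ ≤ λ₃` are the eigenvalues of the coefficient
matrix at `0`: equivalently (the eigenvalues being positive), for any pair of
eigenvalues the corresponding ratio is `< α`. -/
def EigCond (a : Fin 3 → Fin 3 → E3 → ℝ) (α : ℝ) : Prop :=
  ∀ h : (coefMatrix a 0).IsHermitian, ∀ i j : Fin 3,
    (h.eigenvalues i - h.eigenvalues j) / h.eigenvalues j < α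

/-- The coefficients `a¹_jk = μ δ_jk + t_jk` of `P₁`. -/
def a1coef (t : Fin 3 → Fin 3 → E3 → ℝ) (mu : E3 → ℝ) : Fin 3 → Fin 3 → E3 → ℝ :=
  fun j k x => mu x * (if j = k then 1 else 0) + t j k x

/-- The coefficients `a²_jk = (λ + 2μ) δ_jk + t_jk` of `P₂`. -/
def a2coef (t : Fin 3 → Fin 3 → E3 → ℝ) (lam mu : E3 → ℝ) : Fin 3 → Fin 3 → E3 → ℝ :=
  fun j k x => (lam x + 2 * mu x) * (if j = k then 1 else 0) + t j k x

/-- The divergence `∇·u`. -/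
def divg (u : E3 → Fin 3 → ℝ) (x : E3) : ℝ := ∑ i, pd i (fun y => u y i) x

/-- The curl `∇×u`. -/
def curl (u : E3 → Fin 3 → ℝ) (x : E3) : Fin 3 → ℝ :=
  ![pd 1 (fun y => u y 2) x - pd 2 (fun y => u y 1) x,
    pd 2 (fun y => u y 0) x - pd 0 (fun y => u y 2) x,
    pd 0 (fun y => u y 1) x - pd 1 (fun y => u y 0) x]

/-- The infinitesimal strain `E = (∇u + (∇u)ᵗ)/2`. -/
def strain (u : E3 → Fin 3 → ℝ) (x : E3) (i j : Fin 3) : ℝ :=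
  (pd j (fun y => u y i) x + pd i (fun y => u y j) x) / 2

/-- The stress tensor `σ = T + (∇u)T + λ(tr E)I + 2μE`. -/
def stress (t : Fin 3 → Fin 3 → E3 → ℝ) (lam mu : E3 → ℝ) (u : E3 → Fin 3 → ℝ)
    (x : E3) (i j : Fin 3) : ℝ :=
  t i j x + (∑ k, pd k (fun y => u y i) x * t k j x)
    + lam x * divg u x * (if i = j then 1 else 0)
    + 2 * mu x * strain u x i j

/-- The residual stress system `∇·σ + κ²ρu = 0` on `Ω`. -/
def ResSystem (t : Fin 3 → Fin 3 → E3 → ℝ) (lam mu rho : E3 → ℝ) (κ : ℝ)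
    (u : E3 → Fin 3 → ℝ) (Ω : Set E3) : Prop :=
  ∀ x ∈ Ω, ∀ i : Fin 3,
    (∑ j, pd j (fun y => stress t lam mu u y i j) x) + κ ^ 2 * rho x * u x i = 0

/-- The vector `U = (u, ∇·u, ∇×u) : Ω → ℝ⁷`. -/
def Ufull (u : E3 → Fin 3 → ℝ) : E3 → Fin 7 → ℝ :=
  fun x => ![u x 0, u x 1, u x 2, divg u x, curl u x 0, curl u x 1, curl u x 2]

/-- The lower-order term `Σ_{|β|≤3} a_β ∂^β U`, component `i`. -/
def lowOrd (aβ : (Fin 3 → ℕ) → E3 → Fin 7 → Fin 7 → ℝ) (U : E3 → Fin 7 → ℝ)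
    (x : E3) (i : Fin 7) : ℝ :=
  ∑ β ∈ Finset.univ.filter (fun β : Fin 3 → Fin 4 => mdeg (fun k => (β k : ℕ)) ≤ 3),
    ∑ j, aβ (fun k => (β k : ℕ)) x i j * mpd (fun k => (β k : ℕ)) (fun y => U y j) x

open scoped ContDiff

/-- The algebra of smooth real functions on `ℝ³`. -/
def smoothAlgebra : Subalgebra ℝ (E3 → ℝ) where
  carrier := {f | ContDiff ℝ ∞ f}
  mul_mem' := by
    intro f g (hf : ContDiff ℝ ∞ f) (hg : ContDiff ℝ ∞ g)
    exact hf.mul hg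
  add_mem' := by
    intro f g (hf : ContDiff ℝ ∞ f) (hg : ContDiff ℝ ∞ g)
    exact hf.add hg
  algebraMap_mem' := fun c => show ContDiff ℝ ∞ (fun _ : E3 => c) from contDiff_const

/-- Smooth real functions on `ℝ³`. -/
abbrev Smooth : Type := smoothAlgebra

namespace Smooth

variable (f g : Smooth) (x : E3)

lemma contDiff : ContDiff ℝ ∞ (f : E3 → ℝ) := f.2

lemma continuous : Continuous (f : E3 → ℝ) := f.contDiff.continuous

lemma differentiable : Differentiable ℝ (f : E3 → ℝ) := f.contDiff.differentiable (by simp)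

@[simp] lemma add_apply : (f + g : Smooth).1 x = f.1 x + g.1 x := rfl
@[simp] lemma mul_apply : (f * g : Smooth).1 x = f.1 x * g.1 x := rfl
@[simp] lemma neg_apply : (-f : Smooth).1 x = -f.1 x := rfl
@[simp] lemma pow_apply (n : ℕ) : (f ^ n : Smooth).1 x = f.1 x ^ n := rfl
@[simp] lemma zero_apply : (0 : Smooth).1 x = 0 := rfl
@[simp] lemma one_apply : (1 : Smooth).1 x = 1 := rfl
@[simp] lemma natCast_apply (n : ℕ) : ((n : ℕ) : Smooth).1 x = n := by
  induction n with
  | zero => simp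
  | succ n ih => simp [ih]
@[simp] lemma sum_apply {ι : Type*} (s : Finset ι) (F : ι → Smooth) :
    (∑ i ∈ s, F i : Smooth).1 x = ∑ i ∈ s, (F i).1 x := by
  classical
  induction s using Finset.induction_on with
  | empty => simp
  | insert a s ha ih => simp [Finset.sum_insert ha, ih]

lemma contDiff_pd {f : E3 → ℝ} (hf : ContDiff ℝ ∞ f) (i : Fin 3) : ContDiff ℝ ∞ (pd i f) :=
  (hf.fderiv_right (m := ∞) (by simp)).clm_apply contDiff_const

/-- The partial derivative `∂_i` as a derivation of the algebra of smooth functions. -/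
def D (i : Fin 3) : Derivation ℝ Smooth Smooth :=
  Derivation.mk'
    { toFun := fun f => ⟨pd i f.1, contDiff_pd f.2 i⟩
      map_add' := fun f g => Subtype.ext <| funext fun x => by
        change fderiv ℝ (f.1 + g.1) x _ = fderiv ℝ f.1 x _ + fderiv ℝ g.1 x _
        rw [fderiv_add (f.differentiable x) (g.differentiable x)]
        rfl
      map_smul' := fun c f => Subtype.ext <| funext fun x => by
        change fderiv ℝ (c • f.1) x _ = c • fderiv ℝ f.1 x _
        rw [fderiv_const_smul (f.differentiable x)]
        rfl }
    fun f g => Subtype.ext <| funext fun x => by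
      change fderiv ℝ (f.1 * g.1) x _ = f.1 x * fderiv ℝ g.1 x _ + g.1 x * fderiv ℝ f.1 x _
      rw [fderiv_mul (f.differentiable x) (g.differentiable x)]
      rfl

@[simp] lemma D_val (i : Fin 3) (f : Smooth) : (D i f).1 = pd i f.1 := rfl

lemma D_mul (i : Fin 3) (f g : Smooth) : D i (f * g) = f * D i g + D i f * g := by
  rw [Derivation.leibniz, smul_eq_mul, smul_eq_mul, mul_comm g]

lemma D_pow (i : Fin 3) (f : Smooth) (n : ℕ) :
    D i (f ^ (n + 1)) = (n + 1 : ℕ) * f ^ n * D i f := by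
  rw [Derivation.leibniz_pow]
  simp [mul_assoc]

lemma D_comm (i j : Fin 3) (f : Smooth) : D i (D j f) = D j (D i f) := by
  have key : ∀ (i j : Fin 3) (x : E3), (D i (D j f)).1 x =
      fderiv ℝ (fderiv ℝ f.1) x (EuclideanSpace.single i 1) (EuclideanSpace.single j 1) := by
    intro i j x
    change fderiv ℝ (fun y => fderiv ℝ f.1 y (EuclideanSpace.single j 1)) x _ = _
    have h : DifferentiableAt ℝ (fderiv ℝ f.1) x :=
      ((f.contDiff.fderiv_right (m := ∞) (by simp)).differentiable (by simp)) x
    rw [fderiv_clm_apply h (differentiableAt_const _)]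
    simp
  refine Subtype.ext (funext fun x => ?_)
  rw [key, key]
  have := (f.contDiff.contDiffAt (x := x)).isSymmSndFDerivAt
    (by simpa using WithTop.coe_le_coe.2 (le_top : (2 : ℕ∞) ≤ ⊤))
  exact this _ _

/-- Iterated partial derivatives along a word of indices. -/
def Dw : List (Fin 3) → Smooth → Smooth
  | [], f => f
  | i :: w, f => Dw w (D i f)

@[simp] lemma Dw_nil (f : Smooth) : Dw [] f = f := rfl

lemma Dw_cons (i : Fin 3) (w : List (Fin 3)) (f : Smooth) : Dw (i :: w) f = Dw w (D i f) := rfl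

lemma Dw_D (w : List (Fin 3)) (i : Fin 3) (f : Smooth) : Dw w (D i f) = D i (Dw w f) := by
  induction w generalizing f with
  | nil => rfl
  | cons j w ih => rw [Dw_cons, Dw_cons, D_comm, ih]

lemma Dw_add (w : List (Fin 3)) (f g : Smooth) : Dw w (f + g) = Dw w f + Dw w g := by
  induction w generalizing f g with
  | nil => rfl
  | cons j w ih => simp only [Dw_cons, map_add, ih]

lemma Dw_zero (w : List (Fin 3)) : Dw w 0 = 0 := by
  induction w with
  | nil => rfl
  | cons j w ih => simp only [Dw_cons, map_zero, ih]

lemma Dw_sum (w : List (Fin 3)) {ι : Type*} (s : Finset ι) (F : ι → Smooth) :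
    Dw w (∑ i ∈ s, F i) = ∑ i ∈ s, Dw w (F i) := by
  classical
  induction s using Finset.induction_on with
  | empty => simp [Dw_zero]
  | insert a s ha ih => rw [Finset.sum_insert ha, Finset.sum_insert ha, Dw_add, ih]

lemma Dw_append (w v : List (Fin 3)) (f : Smooth) : Dw (w ++ v) f = Dw v (Dw w f) := by
  induction w generalizing f with
  | nil => rfl
  | cons j w ih => exact ih _

lemma Dw_replicate (n : ℕ) (i : Fin 3) (f : Smooth) :
    (Dw (List.replicate n i) f).1 = (pd i)^[n] f.1 := by
  induction n generalizing f with
  | zero => rfl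
  | succ n ih => rw [List.replicate_succ, Dw_cons, ih, Function.iterate_succ_apply]; rfl

/-- The sorted word of a multiindex. -/
def word (β : Fin 3 → ℕ) : List (Fin 3) :=
  List.replicate (β 2) 2 ++ List.replicate (β 1) 1 ++ List.replicate (β 0) 0

lemma length_word (β : Fin 3 → ℕ) : (word β).length = mdeg β := by
  simp [word, mdeg]; omega

lemma Dw_word (β : Fin 3 → ℕ) (f : Smooth) : (Dw (word β) f).1 = mpd β f.1 := by
  rw [word, Dw_append, Dw_append, Dw_replicate, Dw_replicate, Dw_replicate]; rfl

lemma Dw_perm {w v : List (Fin 3)} (h : w.Perm v) (f : Smooth) : Dw w f = Dw v f := by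
  induction h generalizing f with
  | nil => rfl
  | cons i _ ih => exact ih _
  | swap i j l => simp only [Dw_cons, D_comm]
  | trans _ _ ih₁ ih₂ => rw [ih₁, ih₂]

lemma exists_Dw_eq_mpd (w : List (Fin 3)) :
    ∃ β : Fin 3 → ℕ, mdeg β = w.length ∧ ∀ f : Smooth, (Dw w f).1 = mpd β f.1 := by
  refine ⟨fun i => w.count i, ?_, ?_⟩
  · rw [← length_word]
    refine List.Perm.length_eq (List.perm_iff_count.2 fun i => ?_)
    fin_cases i <;> simp [word, List.count_replicate]
  · intro f
    rw [← Dw_word]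
    refine congrArg _ (Dw_perm (List.perm_iff_count.2 fun i => ?_) f)
    fin_cases i <;> simp [word, List.count_replicate]

lemma pd_eqOn {Ω : Set E3} (hΩ : IsOpen Ω) {f g : E3 → ℝ} (h : Set.EqOn f g Ω) (i : Fin 3) :
    Set.EqOn (pd i f) (pd i g) Ω := fun x hx => by
  have : f =ᶠ[nhds x] g := Filter.eventuallyEq_of_mem (hΩ.mem_nhds hx) h
  simp only [pd, this.fderiv_eq]

lemma mpd_eqOn {Ω : Set E3} (hΩ : IsOpen Ω) {f g : E3 → ℝ} (h : Set.EqOn f g Ω)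
    (β : Fin 3 → ℕ) : Set.EqOn (mpd β f) (mpd β g) Ω := by
  have key : ∀ (n : ℕ) (i : Fin 3) (f g : E3 → ℝ), Set.EqOn f g Ω →
      Set.EqOn ((pd i)^[n] f) ((pd i)^[n] g) Ω := by
    intro n i
    induction n with
    | zero => exact fun _ _ h => h
    | succ n ih => exact fun f g h => ih _ _ (pd_eqOn hΩ h i)
  exact key _ _ _ _ (key _ _ _ _ (key _ _ _ _ h))

lemma Dw_eqOn {Ω : Set E3} (hΩ : IsOpen Ω) {f g : Smooth} (h : Set.EqOn f.1 g.1 Ω)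
    (w : List (Fin 3)) : Set.EqOn (Dw w f).1 (Dw w g).1 Ω := by
  obtain ⟨β, -, hβ⟩ := exists_Dw_eq_mpd w
  rw [hβ, hβ]
  exact mpd_eqOn hΩ h β

lemma tsupport_D (i : Fin 3) (f : Smooth) : tsupport (D i f).1 ⊆ tsupport f.1 := by
  refine closure_minimal (fun x hx => ?_) (isClosed_tsupport _)
  by_contra h
  refine hx ?_
  have : pd i f.1 x = pd i 0 x :=
    pd_eqOn (isClosed_tsupport f.1).isOpen_compl
      (fun y hy => image_eq_zero_of_notMem_tsupport hy) i h
  rw [D_val, this]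
  simp [pd]

lemma tsupport_mul_left (f g : Smooth) : tsupport (f * g).1 ⊆ tsupport f.1 :=
  _root_.tsupport_mul_subset_left (f := f.1) (g := g.1)

/-- The operator `Σ a_jk ∂²_{jk}` on smooth functions. -/
def op (a : Fin 3 → Fin 3 → Smooth) (u : Smooth) : Smooth := ∑ j, ∑ k, a j k * D j (D k u)

/-- The `L²` norm over a set `K`. -/
def nrm (K : Set E3) (f : E3 → ℝ) : ℝ := √(∫ x in K, f x ^ 2)

section L2

variable {K : Set E3}

lemma nrm_nonneg (f : E3 → ℝ) : 0 ≤ nrm K f := Real.sqrt_nonneg _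

lemma nrm_sq (f : E3 → ℝ) : nrm K f ^ 2 = ∫ x in K, f x ^ 2 :=
  Real.sq_sqrt (integral_nonneg fun _ => sq_nonneg _)

lemma nrm_congr (hK : IsCompact K) {f g : E3 → ℝ} (h : ∀ x ∈ K, f x = g x) :
    nrm K f = nrm K g := by
  unfold nrm
  rw [setIntegral_congr_fun hK.measurableSet (g := fun x => g x ^ 2)
    fun x hx => by simp only [h x hx]]

lemma integrableOn (hK : IsCompact K) {f : E3 → ℝ} (hf : Continuous f) : IntegrableOn f K :=
  hf.continuousOn.integrableOn_compact hK

lemma nrm_mono (hK : IsCompact K) {f g : E3 → ℝ} (hf : Continuous f) (hg : Continuous g)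
    (h : ∀ x ∈ K, |f x| ≤ |g x|) : nrm K f ≤ nrm K g :=
  Real.sqrt_le_sqrt (setIntegral_mono_on (integrableOn hK (hf.pow 2)) (integrableOn hK (hg.pow 2))
    hK.measurableSet fun x hx => sq_le_sq.2 (h x hx))

lemma integral_combo (hK : IsCompact K) {f g : E3 → ℝ} (hf : Continuous f)
    (hg : Continuous g) (t : ℝ) :
    ∫ x in K, (f x + t * g x) ^ 2 =
      nrm K f ^ 2 + 2 * t * (∫ x in K, f x * g x) + t ^ 2 * nrm K g ^ 2 := by
  have h1 : (fun x => (f x + t * g x) ^ 2) =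
      fun x => (f x ^ 2 + (2 * t) * (f x * g x)) + t ^ 2 * g x ^ 2 := by
    funext x; ring
  have i1 : Integrable (fun x => f x ^ 2) (volume.restrict K) := integrableOn hK (hf.pow 2)
  have i2 : Integrable (fun x => (2 * t) * (f x * g x)) (volume.restrict K) :=
    (integrableOn hK (hf.mul hg)).const_mul _
  have i3 : Integrable (fun x => t ^ 2 * g x ^ 2) (volume.restrict K) :=
    (integrableOn hK (hg.pow 2)).const_mul _
  have i4 : Integrable (fun x => f x ^ 2 + (2 * t) * (f x * g x)) (volume.restrict K) := i1.add i2
  rw [h1, integral_add i4 i3, integral_add i1 i2, integral_const_mul, integral_const_mul,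
    nrm_sq, nrm_sq]

lemma abs_integral_mul_le (hK : IsCompact K) {f g : E3 → ℝ} (hf : Continuous f)
    (hg : Continuous g) : |∫ x in K, f x * g x| ≤ nrm K f * nrm K g := by
  have h : ∀ t : ℝ, 0 ≤ (nrm K g ^ 2) * (t * t) + (2 * ∫ x in K, f x * g x) * t
      + nrm K f ^ 2 := by
    intro t
    have h0 : 0 ≤ ∫ x in K, (f x + t * g x) ^ 2 := integral_nonneg fun _ => sq_nonneg _
    rw [integral_combo hK hf hg] at h0
    linarith
  have h2 := discrim_le_zero h
  rw [discrim] at h2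
  refine abs_le_of_sq_le_sq ?_ (mul_nonneg (nrm_nonneg _) (nrm_nonneg _))
  rw [mul_pow]
  linarith

lemma nrm_add_le (hK : IsCompact K) {f g : E3 → ℝ} (hf : Continuous f) (hg : Continuous g) :
    nrm K (f + g) ≤ nrm K f + nrm K g := by
  refine (abs_le_of_sq_le_sq' ?_ (add_nonneg (nrm_nonneg _) (nrm_nonneg _))).2
  have h1 := integral_combo hK hf hg 1
  have h2 := le_of_abs_le (abs_integral_mul_le hK hf hg)
  simp only [one_mul] at h1
  rw [nrm_sq]
  simp only [Pi.add_apply]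
  rw [h1]
  linarith

lemma nrm_add (hK : IsCompact K) (f g : Smooth) :
    nrm K (f + g).1 ≤ nrm K f.1 + nrm K g.1 := nrm_add_le hK f.continuous g.continuous

lemma nrm_neg (f : Smooth) : nrm K (-f).1 = nrm K f.1 := by simp [nrm]

lemma nrm_sub (hK : IsCompact K) (f g : Smooth) :
    nrm K (f - g).1 ≤ nrm K f.1 + nrm K g.1 := by
  rw [sub_eq_add_neg, ← nrm_neg g]; exact nrm_add hK _ _

@[simp] lemma nrm_zero : nrm K (0 : E3 → ℝ) = 0 := by simp [nrm]

lemma nrm_sum (hK : IsCompact K) {ι : Type*} (s : Finset ι) (F : ι → Smooth) :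
    nrm K (∑ i ∈ s, F i : Smooth).1 ≤ ∑ i ∈ s, nrm K (F i).1 := by
  classical
  induction s using Finset.induction_on with
  | empty => simp
  | insert a s ha ih =>
    rw [Finset.sum_insert ha, Finset.sum_insert ha]
    exact (nrm_add hK _ _).trans (by gcongr)

lemma nrm_mul_le (hK : IsCompact K) (a f : Smooth) {C : ℝ} (hC : 0 ≤ C)
    (ha : ∀ x ∈ K, |a.1 x| ≤ C) : nrm K (a * f).1 ≤ C * nrm K f.1 := by
  have h : nrm K (a * f).1 ≤ nrm K (fun x => C * f.1 x) := by
    refine nrm_mono hK (a * f).continuous (continuous_const.mul f.continuous) fun x hx => ?_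
    rw [mul_apply, abs_mul, abs_mul, abs_of_nonneg hC]
    exact mul_le_mul_of_nonneg_right (ha x hx) (abs_nonneg _)
  refine h.trans_eq ?_
  simp only [nrm, mul_pow]
  rw [integral_const_mul, Real.sqrt_mul (sq_nonneg C), Real.sqrt_sq hC]

lemma integral_D_eq_zero (hK : IsCompact K) (i : Fin 3) (f : Smooth) (hf : tsupport f.1 ⊆ K) :
    ∫ x in K, (D i f).1 x = 0 := by
  have hc : HasCompactSupport f.1 := hK.of_isClosed_subset (isClosed_tsupport _) hf
  have hc' : HasCompactSupport (D i f).1 :=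
    hK.of_isClosed_subset (isClosed_tsupport _) ((tsupport_D i f).trans hf)
  have h0 : ∀ x ∉ K, (D i f).1 x = 0 := fun x hx =>
    image_eq_zero_of_notMem_tsupport fun h => hx (hf (tsupport_D i f h))
  rw [setIntegral_eq_integral_of_forall_compl_eq_zero h0]
  have hi : Integrable (fun x => fderiv ℝ f.1 x (EuclideanSpace.single i 1)) volume :=
    (D i f).continuous.integrable_of_hasCompactSupport hc'
  have := integral_mul_fderiv_eq_neg_fderiv_mul_of_integrable (𝕜 := ℝ) (μ := (volume : Measure E3))
    (f := fun _ : E3 => (1 : ℝ)) (g := f.1) (v := EuclideanSpace.single i 1)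
    (by simp)
    (by simpa only [one_mul] using hi)
    (by simpa only [one_mul] using f.continuous.integrable_of_hasCompactSupport hc)
    (fun _ _ => differentiableAt_const _) (fun x _ => f.differentiable x)
  simpa [pd] using this

end L2

section Sup

open Function

lemma enorm_le_lmarginal (i : Fin 3) (f : Smooth) (hf : HasCompactSupport f.1) :
    (fun x : Fin 3 → ℝ => ‖f.1 (WithLp.toLp 2 x)‖ₑ) ≤
      ∫⋯∫⁻_{i}, (fun x : Fin 3 → ℝ => ‖(D i f).1 (WithLp.toLp 2 x)‖ₑ) ∂fun _ => volume := by
  intro x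
  rw [lmarginal_singleton]
  let e : (Fin 3 → ℝ) ≃L[ℝ] E3 := (EuclideanSpace.equiv (Fin 3) ℝ).symm
  have hF : ContDiff ℝ ∞ (f.1 ∘ e) := f.contDiff.comp e.contDiff
  have hs : HasCompactSupport (f.1 ∘ e) := hf.comp_homeomorph e.toHomeomorph
  have h1 : ContDiff ℝ 1 (fun t => (f.1 ∘ e) (update x i t)) :=
    (hF.of_le (by simp)).comp (contDiff_update 1 x i)
  have h2 := HasCompactSupport.enorm_le_lintegral_Ici_deriv h1
    (hs.comp_isClosedEmbedding (isClosedEmbedding_update x i)) (x i)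
  simp only [update_eq_self] at h2
  refine h2.trans ((setLIntegral_le_lintegral _ _).trans_eq ?_)
  refine lintegral_congr fun t => ?_
  have h3 : HasDerivAt (fun t => e (update x i t)) (e (Pi.single i 1)) t :=
    e.hasFDerivAt.comp_hasDerivAt t (hasDerivAt_update x i t)
  have h4 := (f.differentiable (e (update x i t))).hasFDerivAt.comp_hasDerivAt t h3
  have h5 : deriv (fun t => (f.1 ∘ e) (update x i t)) t = _ := h4.deriv
  rw [h5]
  rfl

lemma abs_le_integral (f : Smooth) (hf : HasCompactSupport f.1) (x : E3) :
    |f.1 x| ≤ ∫ y, |(D 2 (D 1 (D 0 f))).1 y| := by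
  have hD : ∀ (i : Fin 3) (f : Smooth), HasCompactSupport f.1 → HasCompactSupport (D i f).1 :=
    fun i f hf => hf.of_isClosed_subset (isClosed_tsupport _) (tsupport_D i f)
  have hm : ∀ f : Smooth, Measurable (fun x : Fin 3 → ℝ => ‖f.1 (WithLp.toLp 2 x)‖ₑ) := fun f =>
    (f.continuous.measurable.comp (PiLp.volume_preserving_toLp (Fin 3)).measurable).enorm
  have h0 := enorm_le_lmarginal 0 f hf
  have h1 := enorm_le_lmarginal 1 (D 0 f) (hD _ _ hf)
  have h2 := enorm_le_lmarginal 2 (D 1 (D 0 f)) (hD _ _ (hD _ _ hf))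
  have h3 := h0.trans (lmarginal_mono (h1.trans (lmarginal_mono h2)))
  rw [← lmarginal_union _ _ (hm _) (by decide), ← lmarginal_union _ _ (hm _) (by decide)] at h3
  have h4 := h3 x.ofLp
  rw [show ({0} ∪ ({1} ∪ {2}) : Finset (Fin 3)) = Finset.univ from by decide,
    lmarginal_univ] at h4
  change _ ≤ ∫⁻ y : Fin 3 → ℝ, _ ∂volume at h4
  have h5 := (PiLp.volume_preserving_toLp (Fin 3)).lintegral_comp
    (f := fun y => ‖(D 2 (D 1 (D 0 f))).1 y‖ₑ) (D 2 (D 1 (D 0 f))).continuous.measurable.enorm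
  rw [h5] at h4
  have h6 := ((D 2 (D 1 (D 0 f))).continuous.integrable_of_hasCompactSupport
    (μ := volume) (hD _ _ (hD _ _ (hD _ _ hf))))
  have h7 := ofReal_integral_norm_eq_lintegral_enorm h6
  rw [← h7] at h4
  change ‖f.1 x‖ₑ ≤ _ at h4
  rw [← ofReal_norm, ENNReal.ofReal_le_ofReal_iff
    (integral_nonneg fun _ => norm_nonneg _)] at h4
  simpa [Real.norm_eq_abs] using h4

lemma abs_le_nrm {K : Set E3} (hK : IsCompact K) (f : Smooth) (hf : tsupport f.1 ⊆ K) (x : E3) :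
    |f.1 x| ≤ nrm K (fun _ => 1) * nrm K (D 2 (D 1 (D 0 f))).1 := by
  have hc : HasCompactSupport f.1 := hK.of_isClosed_subset (isClosed_tsupport _) hf
  refine (abs_le_integral f hc x).trans ?_
  set g := D 2 (D 1 (D 0 f))
  have h0 : ∀ x ∉ K, |g.1 x| = 0 := fun x hx => by
    rw [abs_eq_zero]
    exact image_eq_zero_of_notMem_tsupport fun h =>
      hx (hf (tsupport_D _ _ (tsupport_D _ _ (tsupport_D _ _ h))))
  rw [← setIntegral_eq_integral_of_forall_compl_eq_zero h0]
  have h1 := (le_abs_self _).trans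
    (abs_integral_mul_le hK (f := fun _ => 1) (g := fun x => |g.1 x|) continuous_const
    g.continuous.abs)
  simpa [nrm] using h1

end Sup

variable {K : Set E3}

/-- The integral over `K`. -/
def intK (K : Set E3) (f : Smooth) : ℝ := ∫ x in K, f.1 x

lemma intK_add (hK : IsCompact K) (f g : Smooth) : intK K (f + g) = intK K f + intK K g :=
  integral_add (integrableOn hK f.continuous) (integrableOn hK g.continuous)

lemma intK_sub (hK : IsCompact K) (f g : Smooth) : intK K (f - g) = intK K f - intK K g :=
  integral_sub (integrableOn hK f.continuous) (integrableOn hK g.continuous)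

lemma intK_sum (hK : IsCompact K) {ι : Type*} (s : Finset ι) (F : ι → Smooth) :
    intK K (∑ i ∈ s, F i) = ∑ i ∈ s, intK K (F i) := by
  classical
  induction s using Finset.induction_on with
  | empty => simp [intK]
  | insert a s ha ih => rw [Finset.sum_insert ha, Finset.sum_insert ha, intK_add hK, ih]

lemma intK_mono (hK : IsCompact K) {f g : Smooth} (h : ∀ x ∈ K, f.1 x ≤ g.1 x) :
    intK K f ≤ intK K g :=
  setIntegral_mono_on (integrableOn hK f.continuous) (integrableOn hK g.continuous)
    hK.measurableSet h

lemma abs_intK_mul_le (hK : IsCompact K) (f g : Smooth) :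
    |intK K (f * g)| ≤ nrm K f.1 * nrm K g.1 :=
  abs_integral_mul_le hK f.continuous g.continuous

lemma intK_sq (f : Smooth) : intK K (f * f) = nrm K f.1 ^ 2 := by
  rw [nrm_sq]
  simp only [intK, mul_apply, sq]

/-- Integration by parts for the quadratic form of `∂_i φ`. -/
lemma intK_form (hK : IsCompact K) (a : Fin 3 → Fin 3 → Smooth) (φ : Smooth)
    (hφ : tsupport φ.1 ⊆ K) (i : Fin 3) :
    intK K (∑ j, ∑ k, a j k * D j (D i φ) * D k (D i φ)) =
      ∑ j, ∑ k, (intK K (D i φ * (D i (a j k) * D j (D k φ)))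
        - intK K (D i φ * (D j (a j k) * D k (D i φ)))) + intK K (D i (D i φ) * op a φ) := by
  have h1 : ∀ j k, intK K (a j k * D j (D i φ) * D k (D i φ)) =
      (intK K (D i φ * (D i (a j k) * D j (D k φ))) - intK K (D i φ * (D j (a j k) * D k (D i φ))))
      + intK K (D i (D i φ) * (a j k * D j (D k φ))) := by
    intro j k
    have h2 : a j k * D j (D i φ) * D k (D i φ) =
        (((D i φ * (D i (a j k) * D j (D k φ))) - (D i φ * (D j (a j k) * D k (D i φ))))
        + D i (D i φ) * (a j k * D j (D k φ))) +
        (D j (D i φ * a j k * D k (D i φ)) - D i (D i φ * a j k * D j (D k φ))) := by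
      simp only [D_mul]
      rw [D_comm k i, D_comm j i (D k φ)]
      ring
    have hs : tsupport (D i φ).1 ⊆ K := (tsupport_D i φ).trans hφ
    have h3 : ∀ l (g : Smooth), intK K (D l (D i φ * a j k * g)) = 0 := fun l g =>
      integral_D_eq_zero hK l _
        ((tsupport_mul_left _ _).trans ((tsupport_mul_left _ _).trans hs))
    rw [h2, intK_add hK, intK_sub hK _ (D i _), h3, h3, intK_add hK, intK_sub hK]
    ring
  simp only [op, Finset.mul_sum, intK_sum hK, h1, Finset.sum_add_distrib]

/-- The interior `H²` estimate for compactly supported functions. -/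
lemma nrm_D_D_le (hK : IsCompact K) (a : Fin 3 → Fin 3 → Smooth) {c₀ C : ℝ} (hc₀ : 0 < c₀)
    (hC : 0 ≤ C)
    (hell : ∀ x ∈ K, ∀ ξ : Fin 3 → ℝ,
      c₀ * (∑ i, ξ i ^ 2) ≤ ∑ j, ∑ k, (a j k).1 x * ξ j * ξ k)
    (ha : ∀ i j k, ∀ x ∈ K, |(D i (a j k)).1 x| ≤ C) (φ : Smooth) (hφ : tsupport φ.1 ⊆ K)
    {Y : ℝ} (hY : ∀ i, nrm K (D i φ).1 ≤ Y) (i j : Fin 3) :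
    nrm K (D i (D j φ)).1 ≤ (18 * C * Y + nrm K (op a φ).1) / c₀ := by
  obtain ⟨p, hp⟩ := Finite.exists_max fun p : Fin 3 × Fin 3 => nrm K (D p.1 (D p.2 φ)).1
  set X := nrm K (D p.1 (D p.2 φ)).1 with hX
  have hXm : ∀ i j, nrm K (D i (D j φ)).1 ≤ X := fun i j => hp (i, j)
  have hX0 : 0 ≤ X := nrm_nonneg _
  have hY0 : 0 ≤ Y := (nrm_nonneg _).trans (hY 0)
  have hP0 : 0 ≤ nrm K (op a φ).1 := nrm_nonneg _
  set q := p.2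
  have hterm : ∀ l m n r : Fin 3, ∀ b : Smooth, (∀ x ∈ K, |b.1 x| ≤ C) →
      |intK K (D l φ * (b * D n (D r φ)))| ≤ C * Y * X := by
    intro l m n r b hb
    refine (abs_intK_mul_le hK _ _).trans ?_
    have := (nrm_mul_le hK b (D n (D r φ)) hC hb).trans
      (mul_le_mul_of_nonneg_left (hXm n r) hC)
    calc _ ≤ Y * (C * X) := mul_le_mul (hY l) this (nrm_nonneg _) hY0
      _ = _ := by ring
  have hlow : c₀ * X ^ 2 ≤ intK K (∑ j, ∑ k, a j k * D j (D q φ) * D k (D q φ)) := by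
    have h1 : intK K (algebraMap ℝ Smooth c₀ * (D p.1 (D q φ) * D p.1 (D q φ))) = c₀ * X ^ 2 := by
      rw [hX, ← intK_sq]
      exact integral_const_mul c₀ _
    rw [← h1]
    refine intK_mono hK fun x hx => ?_
    have h2 := hell x hx fun j => (D j (D q φ)).1 x
    have h3 : (D p.1 (D q φ)).1 x ^ 2 ≤ ∑ j, (D j (D q φ)).1 x ^ 2 :=
      Finset.single_le_sum (f := fun j => (D j (D q φ)).1 x ^ 2) (fun _ _ => sq_nonneg _)
        (Finset.mem_univ _)
    have h4 : c₀ * (D p.1 (D q φ)).1 x ^ 2 ≤ c₀ * ∑ j, (D j (D q φ)).1 x ^ 2 :=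
      mul_le_mul_of_nonneg_left h3 hc₀.le
    simp only [sum_apply, mul_apply]
    refine le_trans (le_of_eq ?_) (h4.trans h2)
    rw [sq]
    rfl
  have hup : intK K (∑ j, ∑ k, a j k * D j (D q φ) * D k (D q φ)) ≤
      (18 * C * Y + nrm K (op a φ).1) * X := by
    rw [intK_form hK a φ hφ q]
    have h1 : intK K (D q (D q φ) * op a φ) ≤ X * nrm K (op a φ).1 :=
      (le_of_abs_le (abs_intK_mul_le hK _ _)).trans (mul_le_mul_of_nonneg_right (hXm _ _) hP0)
    have h2 : ∑ j, ∑ k, (intK K (D q φ * (D q (a j k) * D j (D k φ)))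
        - intK K (D q φ * (D j (a j k) * D k (D q φ)))) ≤
        ∑ _j : Fin 3, ∑ _k : Fin 3, 2 * (C * Y * X) := by
      refine Finset.sum_le_sum fun j _ => Finset.sum_le_sum fun k _ => ?_
      have e1 := le_of_abs_le (hterm q q j k (D q (a j k)) (ha _ _ _))
      have e2 := neg_le_of_abs_le (hterm q q k q (D j (a j k)) (ha _ _ _))
      linarith
    simp only [Finset.sum_const, Finset.card_univ, Fintype.card_fin, nsmul_eq_mul] at h2
    push_cast at h2
    linarith
  refine (hXm i j).trans ?_
  rw [le_div_iff₀ hc₀]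
  rcases hX0.eq_or_lt with h | h
  · rw [← h, zero_mul]; positivity
  · have := hlow.trans hup
    nlinarith

lemma nrm_pow_mul_mono (hK : IsCompact K) (χ : Smooth) (h0 : ∀ x, 0 ≤ χ.1 x)
    (h1 : ∀ x, χ.1 x ≤ 1) {m n : ℕ} (h : m ≤ n) (f : Smooth) :
    nrm K (χ ^ n * f).1 ≤ nrm K (χ ^ m * f).1 := by
  refine nrm_mono hK (χ ^ n * f).continuous (χ ^ m * f).continuous fun x _ => ?_
  simp only [mul_apply, pow_apply, abs_mul, abs_pow, abs_of_nonneg (h0 x)]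
  exact mul_le_mul_of_nonneg_right (pow_le_pow_of_le_one (h0 x) (h1 x) h) (abs_nonneg _)

lemma exists_bound (hK : IsCompact K) {ι : Type*} [Finite ι] (F : ι → Smooth) :
    ∃ C : ℝ, 1 ≤ C ∧ ∀ i, ∀ x ∈ K, |(F i).1 x| ≤ C := by
  have h : ∀ i, ∃ C, ∀ x ∈ K, |(F i).1 x| ≤ C := fun i => by
    simpa using hK.exists_bound_of_continuousOn (F i).continuous.continuousOn
  choose C hC using h
  have := Fintype.ofFinite ι
  refine ⟨1 + ∑ i, |C i|, le_add_of_nonneg_right (Finset.sum_nonneg fun i _ => abs_nonneg (C i)),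
    fun i x hx => ?_⟩
  have := Finset.single_le_sum (f := fun i => |C i|) (fun i _ => abs_nonneg (C i))
    (Finset.mem_univ i)
  linarith [hC i x hx, le_abs_self (C i)]

/-- The `H²` estimate with powers of a cut-off function as weights. -/
lemma exists_weighted_estimate (χ : Smooth) (hK : IsCompact (tsupport χ.1))
    (h0 : ∀ x, 0 ≤ χ.1 x) (h1 : ∀ x, χ.1 x ≤ 1) (a : Fin 3 → Fin 3 → Smooth)
    {c₀ : ℝ} (hc₀ : 0 < c₀)
    (hell : ∀ x ∈ tsupport χ.1, ∀ ξ : Fin 3 → ℝ,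
      c₀ * (∑ i, ξ i ^ 2) ≤ ∑ j, ∑ k, (a j k).1 x * ξ j * ξ k) :
    ∃ C : ℝ, 0 < C ∧ ∀ (n : ℕ) (v : Smooth) (y₀ y₁ : ℝ),
      nrm (tsupport χ.1) (χ ^ n * v).1 ≤ y₀ →
      (∀ i, nrm (tsupport χ.1) (χ ^ (n + 1) * D i v).1 ≤ y₁) → ∀ i j,
      nrm (tsupport χ.1) (χ ^ (n + 2) * D i (D j v)).1 ≤
        C * (nrm (tsupport χ.1) (χ ^ (n + 2) * op a v).1 + (n + 2) * y₁ + (n + 2) ^ 2 * y₀) := by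
  obtain ⟨M₁, hM₁1, hM₁⟩ := exists_bound hK fun p : Fin 3 × Fin 3 => D p.1 (D p.2 χ)
  obtain ⟨M₂, hM₂1, hM₂⟩ := exists_bound hK fun i : Fin 3 => D i χ
  obtain ⟨M₃, hM₃1, hM₃⟩ := exists_bound hK fun p : Fin 3 × Fin 3 × Fin 3 => D p.1 (a p.2.1 p.2.2)
  obtain ⟨M₄, hM₄1, hM₄⟩ := exists_bound hK fun p : Fin 3 × Fin 3 => a p.1 p.2
  set K := tsupport χ.1 with hKdef
  set M := M₁ + M₂ ^ 2 with hM
  have hMM₂ : M₂ ≤ M := by nlinarith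
  have hM1 : 1 ≤ M := by linarith
  refine ⟨(1 + 18 * M₃ * M + 18 * M₄ * M) / c₀ + 2 * M, by positivity, ?_⟩
  intro n v y₀ y₁ hy₀ hy₁ i j
  have hy₀' : 0 ≤ y₀ := (nrm_nonneg _).trans hy₀
  have hy₁' : 0 ≤ y₁ := (nrm_nonneg _).trans (hy₁ 0)
  set T : ℝ := (n + 2) * y₁ + (n + 2) ^ 2 * y₀ with hT
  have hT0 : 0 ≤ T := by positivity
  set φ := χ ^ (n + 2) * v with hφ
  have hsupp : tsupport φ.1 ⊆ K := by
    rw [hφ, pow_succ', mul_assoc]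
    exact tsupport_mul_left _ _
  have hD : ∀ k, D k φ = χ ^ (n + 2) * D k v + (n + 2 : ℕ) * (D k χ * (χ ^ (n + 1) * v)) := by
    intro k
    rw [hφ, D_mul, D_pow]
    push_cast
    ring
  have hDD : ∀ j k, D j (D k φ) = χ ^ (n + 2) * D j (D k v) +
      ((n + 2 : ℕ) * (D j χ * (χ ^ (n + 1) * D k v) + D k χ * (χ ^ (n + 1) * D j v)) +
      ((n + 2 : ℕ) * (D j (D k χ) * (χ ^ (n + 1) * v)) +
      ((n + 2 : ℕ) * (n + 1 : ℕ) : Smooth) * (D k χ * (D j χ * (χ ^ n * v))))) := by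
    intro j k
    rw [hD, map_add, D_mul, D_pow, D_mul, D_mul, D_mul, D_pow, Derivation.map_natCast]
    push_cast
    ring
  have hnat : ∀ (m : ℕ) (f : Smooth), nrm K ((m : Smooth) * f).1 ≤ m * nrm K f.1 := fun m f =>
    nrm_mul_le hK _ _ (Nat.cast_nonneg m) fun x _ => by simp
  have hχv : nrm K (χ ^ (n + 1) * v).1 ≤ y₀ :=
    (nrm_pow_mul_mono hK χ h0 h1 (Nat.le_succ n) v).trans hy₀
  have hY : ∀ k, nrm K (D k φ).1 ≤ M * T := by
    intro k
    rw [hD]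
    have e1 : nrm K (χ ^ (n + 2) * D k v).1 ≤ y₁ :=
      (nrm_pow_mul_mono hK χ h0 h1 (Nat.le_succ (n + 1)) _).trans (hy₁ k)
    have e2 := hnat (n + 2) (D k χ * (χ ^ (n + 1) * v))
    have e3 := (nrm_mul_le hK (D k χ) (χ ^ (n + 1) * v) (by positivity) (hM₂ k)).trans
      (mul_le_mul hMM₂ hχv (nrm_nonneg _) (by positivity))
    have e4 := mul_le_mul_of_nonneg_left e3 (Nat.cast_nonneg (α := ℝ) (n + 2))
    refine (nrm_add hK _ _).trans ((add_le_add e1 (e2.trans e4)).trans ?_)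
    have hn : (0 : ℝ) ≤ n := Nat.cast_nonneg n
    push_cast
    have e5 : y₁ ≤ M * ((n + 2) * y₁) := by
      have : 1 * y₁ ≤ (M * (n + 2)) * y₁ := mul_le_mul_of_nonneg_right (by nlinarith) hy₁'
      linarith
    have e6 : (n + 2) * (M * y₀) ≤ M * ((n + 2) ^ 2 * y₀) := by
      have : ((n : ℝ) + 2) * (M * y₀) ≤ ((n + 2) * (n + 2)) * (M * y₀) :=
        mul_le_mul_of_nonneg_right (by nlinarith) (by positivity)
      linarith
    rw [hT, mul_add]
    linarith
  have hE : ∀ j k, nrm K (D j (D k φ) - χ ^ (n + 2) * D j (D k v)).1 ≤ 2 * M * T := by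
    intro j k
    rw [hDD, add_sub_cancel_left]
    have f1 : ∀ j k, nrm K (D j χ * (χ ^ (n + 1) * D k v)).1 ≤ M * y₁ := fun j k =>
      (nrm_mul_le hK (D j χ) _ (by positivity) (hM₂ j)).trans
        (mul_le_mul hMM₂ (hy₁ k) (nrm_nonneg _) (by positivity))
    have f2 := (hnat (n + 2) (D j χ * (χ ^ (n + 1) * D k v) + D k χ * (χ ^ (n + 1) * D j v))).trans
      (mul_le_mul_of_nonneg_left ((nrm_add hK _ _).trans (add_le_add (f1 j k) (f1 k j)))
        (Nat.cast_nonneg (α := ℝ) (n + 2)))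
    have f3 := (hnat (n + 2) (D j (D k χ) * (χ ^ (n + 1) * v))).trans
      (mul_le_mul_of_nonneg_left ((nrm_mul_le hK (D j (D k χ)) _ (by positivity)
        (hM₁ (j, k))).trans (mul_le_mul_of_nonneg_left hχv (by positivity)))
        (Nat.cast_nonneg (α := ℝ) (n + 2)))
    have f4 : nrm K (D k χ * (D j χ * (χ ^ n * v))).1 ≤ M₂ * (M₂ * y₀) :=
      (nrm_mul_le hK (D k χ) _ (by positivity) (hM₂ k)).trans
        (mul_le_mul_of_nonneg_left ((nrm_mul_le hK (D j χ) _ (by positivity) (hM₂ j)).trans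
          (mul_le_mul_of_nonneg_left hy₀ (by positivity))) (by positivity))
    have f5 := (hnat ((n + 2) * (n + 1)) (D k χ * (D j χ * (χ ^ n * v)))).trans
      (mul_le_mul_of_nonneg_left f4 (Nat.cast_nonneg (α := ℝ) _))
    rw [← Nat.cast_mul]
    refine (nrm_add hK _ _).trans ((add_le_add f2 ((nrm_add hK _ _).trans
      (add_le_add f3 f5))).trans ?_)
    have hn : (0 : ℝ) ≤ n := Nat.cast_nonneg n
    push_cast
    have g1 : ((n : ℝ) + 2) * (M₁ * y₀) ≤ (n + 2) ^ 2 * (M₁ * y₀) :=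
      mul_le_mul_of_nonneg_right (by nlinarith) (by positivity)
    have g2 : ((n : ℝ) + 2) * (n + 1) * (M₂ * (M₂ * y₀)) ≤ (n + 2) ^ 2 * (M₂ * (M₂ * y₀)) :=
      mul_le_mul_of_nonneg_right (by nlinarith) (by positivity)
    have g3 : 0 ≤ ((n : ℝ) + 2) ^ 2 * (M * y₀) := by positivity
    have g4 : 2 * M * T = 2 * ((n + 2) * (M * y₁)) + 2 * ((n + 2) ^ 2 * (M * y₀)) := by
      rw [hT]; ring
    have g5 : ((n : ℝ) + 2) ^ 2 * (M * y₀) =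
        (n + 2) ^ 2 * (M₁ * y₀) + (n + 2) ^ 2 * (M₂ * (M₂ * y₀)) := by rw [hM]; ring
    linarith
  have hP : nrm K (op a φ).1 ≤ nrm K (χ ^ (n + 2) * op a v).1 + 18 * M₄ * M * T := by
    have e1 : op a φ = χ ^ (n + 2) * op a v +
        ∑ j, ∑ k, a j k * (D j (D k φ) - χ ^ (n + 2) * D j (D k v)) := by
      simp only [op, Finset.mul_sum, ← Finset.sum_add_distrib]
      refine Finset.sum_congr rfl fun j _ => Finset.sum_congr rfl fun k _ => ?_
      ring
    rw [e1]
    refine (nrm_add hK _ _).trans (add_le_add le_rfl ?_)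
    refine (nrm_sum hK _ _).trans ((Finset.sum_le_sum fun j _ => (nrm_sum hK _ _).trans
      (Finset.sum_le_sum fun k _ => (nrm_mul_le hK (a j k) _ (by positivity) (hM₄ (j, k))).trans
        (mul_le_mul_of_nonneg_left (hE j k) (by positivity)))).trans_eq ?_)
    simp
    ring
  have hfin := nrm_D_D_le hK a hc₀ (by positivity) hell (fun i j k => hM₃ (i, j, k)) φ hsupp hY i j
  have hlast : nrm K (χ ^ (n + 2) * D i (D j v)).1 ≤ nrm K (D i (D j φ)).1 + 2 * M * T := by
    have : χ ^ (n + 2) * D i (D j v) =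
        D i (D j φ) - (D i (D j φ) - χ ^ (n + 2) * D i (D j v)) := by ring
    rw [this]
    exact (nrm_sub hK _ _).trans (add_le_add le_rfl (hE i j))
  set Q := nrm K (χ ^ (n + 2) * op a v).1
  have hQ : 0 ≤ Q := nrm_nonneg _
  have hstep : (18 * M₃ * (M * T) + nrm K (op a φ).1) / c₀ ≤
      (1 + 18 * M₃ * M + 18 * M₄ * M) / c₀ * (Q + T) := by
    rw [div_mul_eq_mul_div]
    refine div_le_div_of_nonneg_right ?_ hc₀.le
    have : 0 ≤ (18 * M₃ * M + 18 * M₄ * M) * Q := by positivity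
    nlinarith
  have : 0 ≤ 2 * M * Q := by positivity
  calc _ ≤ (1 + 18 * M₃ * M + 18 * M₄ * M) / c₀ * (Q + T) + 2 * M * T := by linarith
    _ ≤ ((1 + 18 * M₃ * M + 18 * M₄ * M) / c₀ + 2 * M) * (Q + T) := by nlinarith
    _ = _ := by rw [hT]; ring

end Smooth

/-- The `n`-th coefficient of the binomial convolution of two sequences. -/
def binConv (n : ℕ) (α γ : ℕ → ℝ) : ℝ :=
  ∑ p ∈ antidiagonal n, (n.choose p.1 : ℝ) * (α p.1 * γ p.2)

lemma binConv_zero (α γ : ℕ → ℝ) : binConv 0 α γ = α 0 * γ 0 := by simp [binConv]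

lemma binConv_succ (n : ℕ) (α γ : ℕ → ℝ) :
    binConv (n + 1) α γ =
      binConv n α (fun k => γ (k + 1)) + binConv n (fun k => α (k + 1)) γ := by
  rw [binConv, Finset.sum_antidiagonal_choose_succ_mul (fun i j => α i * γ j)]
  congr 1
  refine Finset.sum_congr rfl fun p hp => ?_
  rw [Nat.choose_symm_of_eq_add (mem_antidiagonal.1 hp).symm]

lemma binConv_eq (n : ℕ) (α γ : ℕ → ℝ) :
    binConv n α γ = α 0 * γ n +
      ∑ j ∈ range n, (n.choose (j + 1) : ℝ) * (α (j + 1) * γ (n - (j + 1))) := by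
  rw [binConv, Finset.Nat.sum_antidiagonal_eq_sum_range_succ_mk, Finset.sum_range_succ']
  simp [add_comm]

/-- The Gevrey majorant `Lⁿ (n!)ˢ`. -/
def gev (s L : ℝ) (n : ℕ) : ℝ := L ^ n * (n.factorial : ℝ) ^ s

section Gevrey

variable {s L : ℝ}

lemma gev_pos (hL : 0 < L) (n : ℕ) : 0 < gev s L n := by
  have : (0 : ℝ) < n.factorial := by exact_mod_cast n.factorial_pos
  unfold gev
  positivity

lemma gev_succ (n : ℕ) : gev s L (n + 1) = L * ((n : ℝ) + 1) ^ s * gev s L n := by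
  have h : ((n + 1).factorial : ℝ) = ((n : ℝ) + 1) * n.factorial := by
    push_cast [Nat.factorial_succ]; ring
  rw [gev, gev, h, Real.mul_rpow (by positivity) (by positivity), pow_succ]
  ring

lemma mul_gev_le (hs : 1 ≤ s) (hL : 0 < L) (n : ℕ) :
    L * ((n : ℝ) + 1) * gev s L n ≤ gev s L (n + 1) := by
  rw [gev_succ]
  have h : ((n : ℝ) + 1) ≤ ((n : ℝ) + 1) ^ s :=
    Real.self_le_rpow_of_one_le (by linarith [Nat.cast_nonneg (α := ℝ) n]) hs
  have := (gev_pos (s := s) hL n).le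
  gcongr

lemma gev_mono (hs : 1 ≤ s) (hL : 1 ≤ L) {m n : ℕ} (h : m ≤ n) : gev s L m ≤ gev s L n := by
  refine monotone_nat_of_le_succ (fun n => ?_) h
  refine le_trans ?_ (mul_gev_le hs (by linarith) n)
  have := (gev_pos (s := s) (L := L) (by linarith) n).le
  have h2 : 1 ≤ L * ((n : ℝ) + 1) := by nlinarith [Nat.cast_nonneg (α := ℝ) n]
  nlinarith

lemma choose_mul_factorial_rpow_le (hs : 1 ≤ s) {n j : ℕ} (h : j ≤ n) (e : ℕ) :
    (n.choose j : ℝ) * ((j.factorial : ℝ) ^ s * ((n - j + e).factorial : ℝ) ^ s) ≤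
      ((n + e).factorial : ℝ) ^ s := by
  have h1 : n.choose j * (j.factorial * (n - j + e).factorial) ≤ (n + e).factorial := by
    rw [← Nat.choose_mul_factorial_mul_factorial (h.trans (Nat.le_add_right n e)),
      show n + e - j = n - j + e by omega, mul_assoc]
    exact Nat.mul_le_mul_right _ (Nat.choose_le_choose _ (Nat.le_add_right n e))
  have h2 : (1 : ℝ) ≤ n.choose j := by exact_mod_cast Nat.choose_pos h
  calc _ ≤ (n.choose j : ℝ) ^ s * ((j.factorial : ℝ) ^ s * ((n - j + e).factorial : ℝ) ^ s) := by
        gcongr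
        exact Real.self_le_rpow_of_one_le h2 hs
    _ = ((n.choose j * (j.factorial * (n - j + e).factorial) : ℕ) : ℝ) ^ s := by
        push_cast
        rw [Real.mul_rpow (by positivity) (by positivity),
          Real.mul_rpow (by positivity) (by positivity)]
    _ ≤ _ := by
        gcongr

lemma choose_mul_gev_le (hs : 1 ≤ s) {A : ℝ} (hA : 0 < A) (hL : 0 < L) {n j : ℕ} (h : j ≤ n)
    (e : ℕ) :
    (n.choose j : ℝ) * (gev s A j * gev s L (n - j + e)) ≤ (A / L) ^ j * gev s L (n + e) := by
  have h1 : A ^ j * L ^ (n - j + e) = (A / L) ^ j * L ^ (n + e) := by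
    rw [show n + e = j + (n - j + e) by omega, pow_add L j, div_pow]
    field_simp
  calc _ = A ^ j * L ^ (n - j + e) *
        ((n.choose j : ℝ) * ((j.factorial : ℝ) ^ s * ((n - j + e).factorial : ℝ) ^ s)) := by
        unfold gev; ring
    _ ≤ A ^ j * L ^ (n - j + e) * ((n + e).factorial : ℝ) ^ s := by
        gcongr
        exact choose_mul_factorial_rpow_le hs h e
    _ = _ := by rw [h1, gev]; ring

/-- The binomial convolution of Gevrey majorants, without its top-order term. -/
lemma binConv_gev_sub_le (hs : 1 ≤ s) {A c B : ℝ} (hA : 0 < A) (hAL : 2 * A ≤ L) (hc : 0 ≤ c)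
    (hB : 0 ≤ B) (n e : ℕ) :
    binConv n (fun j => c * gev s A j) (fun j => B * gev s L (j + e))
      - c * gev s A 0 * (B * gev s L (n + e)) ≤ c * (2 * A / L) * (B * gev s L (n + e)) := by
  have hL : 0 < L := by linarith
  have hG := (gev_pos (s := s) hL (n + e)).le
  rw [binConv_eq, add_sub_cancel_left]
  have hterm : ∀ j ∈ range n, (n.choose (j + 1) : ℝ) *
      (c * gev s A (j + 1) * (B * gev s L (n - (j + 1) + e))) ≤
      c * B * (A / L) * gev s L (n + e) * (1 / 2) ^ j := by
    intro j hj
    have h1 := choose_mul_gev_le hs hA hL (show j + 1 ≤ n from mem_range.1 hj) e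
    have h2 : (A / L) ^ (j + 1) ≤ A / L * (1 / 2) ^ j := by
      rw [pow_succ']
      have : A / L ≤ 1 / 2 := by rw [div_le_iff₀ hL]; linarith
      gcongr
    calc _ = c * B * ((n.choose (j + 1) : ℝ) * (gev s A (j + 1) *
          gev s L (n - (j + 1) + e))) := by ring
      _ ≤ c * B * ((A / L) ^ (j + 1) * gev s L (n + e)) := by gcongr
      _ ≤ c * B * (A / L * (1 / 2) ^ j * gev s L (n + e)) := by gcongr
      _ = _ := by ring
  refine (Finset.sum_le_sum hterm).trans ?_
  rw [← Finset.mul_sum]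
  have h3 := sum_geometric_two_le n
  calc _ ≤ c * B * (A / L) * gev s L (n + e) * 2 := by gcongr
    _ = _ := by ring

lemma binConv_gev_le (hs : 1 ≤ s) {A c B : ℝ} (hA : 0 < A) (hAL : 2 * A ≤ L) (hc : 0 ≤ c)
    (hB : 0 ≤ B) (n e : ℕ) :
    binConv n (fun j => c * gev s A j) (fun j => B * gev s L (j + e)) ≤
      2 * c * (B * gev s L (n + e)) := by
  have hL : 0 < L := by linarith
  have h1 := binConv_gev_sub_le hs hA hAL hc hB n e
  have h2 : gev s A 0 = 1 := by simp [gev]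
  have h3 : 2 * A / L ≤ 1 := by rw [div_le_one hL]; linarith
  have h4 : 0 ≤ B * gev s L (n + e) := mul_nonneg hB (gev_pos hL _).le
  have h5 : c * (2 * A / L) * (B * gev s L (n + e)) ≤ c * 1 * (B * gev s L (n + e)) := by gcongr
  rw [h2] at h1
  linarith

end Gevrey

namespace Smooth

variable {K : Set E3}

/-- Weighted Leibniz estimate. -/
lemma nrm_Dw_mul_le (hK : IsCompact K) (ψ : Smooth) (w : List (Fin 3)) (a g : Smooth)
    (α γ : ℕ → ℝ) (hα : ∀ n, 0 ≤ α n)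
    (ha : ∀ v : List (Fin 3), v.length ≤ w.length → ∀ x ∈ K, |(Dw v a).1 x| ≤ α v.length)
    (hg : ∀ v : List (Fin 3), v.length ≤ w.length → nrm K (ψ * Dw v g).1 ≤ γ v.length) :
    nrm K (ψ * Dw w (a * g)).1 ≤ binConv w.length α γ := by
  induction w generalizing a g α γ with
  | nil =>
    rw [List.length_nil, binConv_zero, Dw_nil, mul_left_comm]
    exact (nrm_mul_le hK a _ (hα 0) (ha [] le_rfl)).trans
      (mul_le_mul_of_nonneg_left (hg [] le_rfl) (hα 0))
  | cons i w ih =>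
    rw [List.length_cons, binConv_succ, Dw_cons, D_mul, Dw_add, mul_add]
    refine (nrm_add hK _ _).trans (add_le_add ?_ ?_)
    · exact ih a (D i g) α _ hα (fun v hv => ha v (hv.trans (Nat.le_succ _)))
        (fun v hv => hg (i :: v) (Nat.succ_le_succ hv))
    · exact ih (D i a) g _ γ (fun n => hα (n + 1)) (fun v hv => ha (i :: v) (Nat.succ_le_succ hv))
        (fun v hv => hg v (hv.trans (Nat.le_succ _)))

/-- Weighted estimate of the commutator of a derivative with a multiplication. -/
lemma nrm_commutator_le (hK : IsCompact K) (ψ : Smooth) (w : List (Fin 3)) (a g : Smooth)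
    (α γ : ℕ → ℝ) (hα : ∀ n, 0 ≤ α n)
    (ha : ∀ v : List (Fin 3), v.length ≤ w.length → ∀ x ∈ K, |(Dw v a).1 x| ≤ α v.length)
    (hg : ∀ v : List (Fin 3), v.length < w.length → nrm K (ψ * Dw v g).1 ≤ γ v.length) :
    nrm K (ψ * (Dw w (a * g) - a * Dw w g)).1 ≤
      binConv w.length α γ - α 0 * γ w.length := by
  induction w generalizing g γ with
  | nil => simp [binConv_zero]
  | cons i w ih =>
    have h : ψ * (Dw (i :: w) (a * g) - a * Dw (i :: w) g) =
        ψ * (Dw w (a * D i g) - a * Dw w (D i g)) + ψ * Dw w (D i a * g) := by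
      rw [Dw_cons, D_mul, Dw_add, Dw_cons]; ring
    rw [List.length_cons, binConv_succ, h, add_sub_right_comm]
    refine (nrm_add hK _ _).trans (add_le_add ?_ ?_)
    · exact ih (D i g) _ (fun v hv => ha v (hv.trans (Nat.le_succ _)))
        (fun v hv => hg (i :: v) (Nat.succ_lt_succ hv))
    · exact nrm_Dw_mul_le hK ψ w (D i a) g _ γ (fun n => hα (n + 1))
        (fun v hv => ha (i :: v) (Nat.succ_le_succ hv))
        (fun v hv => hg v (Nat.lt_succ_of_le hv))

/-- Gevrey bounds on `K` for all iterated derivatives. -/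
def GevBound (K : Set E3) (s c A : ℝ) (f : Smooth) : Prop :=
  ∀ w : List (Fin 3), ∀ x ∈ K, |(Dw w f).1 x| ≤ c * gev s A w.length

variable {s : ℝ}

/-- A weighted Gevrey bound for the derivatives of `op a u` of order `k` gives one for the
derivatives of `u` of order `k + 2`, up to a lower order error. -/
lemma exists_step (χ : Smooth) (hK : IsCompact (tsupport χ.1)) (h0 : ∀ x, 0 ≤ χ.1 x)
    (h1 : ∀ x, χ.1 x ≤ 1) (a : Fin 3 → Fin 3 → Smooth) {c₀ : ℝ} (hc₀ : 0 < c₀)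
    (hell : ∀ x ∈ tsupport χ.1, ∀ ξ : Fin 3 → ℝ,
      c₀ * (∑ i, ξ i ^ 2) ≤ ∑ j, ∑ k, (a j k).1 x * ξ j * ξ k)
    (hs : 1 ≤ s) {A c : ℝ} (hA : 0 < A) (hc : 0 ≤ c)
    (ha : ∀ j k, GevBound (tsupport χ.1) s c A (a j k)) :
    ∃ C : ℝ, 0 < C ∧ ∀ L : ℝ, 1 ≤ L → 2 * A ≤ L → ∀ (e k : ℕ) (u : Smooth) (B F : ℝ),
      0 ≤ B → 0 ≤ F →
      (∀ w : List (Fin 3), w.length ≤ k + 1 →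
        nrm (tsupport χ.1) (χ ^ (w.length + e) * Dw w u).1 ≤ B * gev s L (w.length + e)) →
      (∀ w : List (Fin 3), w.length = k →
        nrm (tsupport χ.1) (χ ^ (w.length + e + 2) * Dw w (op a u)).1 ≤
          F * gev s L (w.length + e + 2)) →
      ∀ w : List (Fin 3), w.length = k + 2 →
        nrm (tsupport χ.1) (χ ^ (w.length + e) * Dw w u).1 ≤
          C * (F + B / L) * gev s L (w.length + e) := by
  obtain ⟨C, hC, hCest⟩ := exists_weighted_estimate χ hK h0 h1 a hc₀ hell
  refine ⟨C * (18 * c * A + 4), by positivity, ?_⟩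
  intro L hL1 hAL e k u B F hB hF hu hop w hw
  have hL : 0 < L := by linarith
  obtain ⟨i, j, w, rfl⟩ : ∃ i j v, w = i :: j :: v := by
    match w, hw with
    | i :: j :: v, _ => exact ⟨i, j, v, rfl⟩
  simp only [List.length_cons, Nat.add_right_cancel_iff] at hw
  subst hw
  set K := tsupport χ.1
  set n := w.length with hn
  set G := gev s L (n + e + 2) with hG
  have hG0 : 0 < G := gev_pos hL _
  have hlen : (i :: j :: w).length + e = n + e + 2 := by simp only [List.length_cons]; omega
  rw [hlen, Dw_cons, Dw_cons, Dw_D, Dw_D]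
  have hy₀ := hu w (Nat.le_succ _)
  have hy₁ : ∀ i, nrm K (χ ^ (n + e + 1) * D i (Dw w u)).1 ≤ B * gev s L (n + e + 1) := by
    intro i
    have := hu (i :: w) le_rfl
    rw [Dw_cons, Dw_D, List.length_cons, add_right_comm] at this
    exact this
  have hcomm : ∀ j k, nrm K (χ ^ (n + e + 2) *
      (Dw w (a j k * D j (D k u)) - a j k * Dw w (D j (D k u)))).1 ≤
      c * (2 * A / L) * (B * G) := by
    intro j k
    have h2 := nrm_commutator_le hK (χ ^ (n + e + 2)) w (a j k) (D j (D k u))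
      (fun m => c * gev s A m) (fun m => B * gev s L (m + (e + 2)))
      (fun m => mul_nonneg hc (gev_pos hA m).le) (fun v _ => ha j k v) (fun v hv => ?_)
    · exact h2.trans (binConv_gev_sub_le hs hA hAL hc hB _ _)
    · have h3 := hu (k :: j :: v) (by simp only [List.length_cons]; omega)
      have h4 : (k :: j :: v).length + e = v.length + (e + 2) := by
        simp only [List.length_cons]; omega
      rw [h4] at h3
      exact (nrm_pow_mul_mono hK χ h0 h1 (by omega) _).trans h3
  have hopv : nrm K (χ ^ (n + e + 2) * op a (Dw w u)).1 ≤
      F * G + 9 * (c * (2 * A / L) * (B * G)) := by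
    have h2 : χ ^ (n + e + 2) * op a (Dw w u) = χ ^ (n + e + 2) * Dw w (op a u) -
        ∑ j, ∑ k, χ ^ (n + e + 2) *
          (Dw w (a j k * D j (D k u)) - a j k * Dw w (D j (D k u))) := by
      simp only [op, Dw_sum, Finset.mul_sum, ← Finset.sum_sub_distrib, Dw_D]
      refine Finset.sum_congr rfl fun j _ => Finset.sum_congr rfl fun k _ => ?_
      ring
    rw [h2]
    refine (nrm_sub hK _ _).trans (add_le_add (hop w rfl) ?_)
    refine (nrm_sum hK _ _).trans ((Finset.sum_le_sum fun j _ => (nrm_sum hK _ _).trans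
      (Finset.sum_le_sum fun k _ => hcomm j k)).trans_eq ?_)
    simp only [Finset.sum_const, Finset.card_univ, Fintype.card_fin, nsmul_eq_mul]
    push_cast
    ring
  have hfin := hCest (n + e) (Dw w u) _ _ hy₀ hy₁ j i
  have g1 := mul_gev_le hs hL (n + e)
  have g2 := mul_gev_le hs hL (n + e + 1)
  set g₀ := gev s L (n + e)
  set g₁ := gev s L (n + e + 1)
  have hg₀ : 0 < g₀ := gev_pos hL _
  have hg₁ : 0 < g₁ := gev_pos hL _
  set N : ℝ := ((n + e : ℕ) : ℝ) with hN
  have hN0 : 0 ≤ N := Nat.cast_nonneg _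
  have g2' : (N + 2) * g₁ ≤ G / L := by
    rw [le_div_iff₀ hL]
    push_cast at g2
    rw [hN]
    push_cast
    linarith
  have g3 : (N + 2) ^ 2 * g₀ ≤ 2 * (G / L) := by
    have e1 : (N + 1) * g₀ ≤ g₁ := by
      have : (N + 1) * g₀ ≤ L * ((N + 1) * g₀) := le_mul_of_one_le_left (by positivity) hL1
      linarith
    have e2 : (N + 2) ^ 2 * g₀ ≤ (2 * (N + 2)) * ((N + 1) * g₀) := by
      have : 0 ≤ (N + 2) * N * g₀ := by positivity
      linarith
    have e3 : (2 * (N + 2)) * ((N + 1) * g₀) ≤ (2 * (N + 2)) * g₁ := by gcongr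
    linarith
  have h5 : (N + 2) * (B * g₁) ≤ B * (G / L) := by
    calc _ = B * ((N + 2) * g₁) := by ring
      _ ≤ _ := by gcongr
  have h6 : (N + 2) ^ 2 * (B * g₀) ≤ B * (2 * (G / L)) := by
    calc _ = B * ((N + 2) ^ 2 * g₀) := by ring
      _ ≤ _ := by gcongr
  refine hfin.trans ?_
  rw [mul_assoc C, mul_assoc C]
  refine mul_le_mul_of_nonneg_left ?_ hC.le
  have h7 : 0 ≤ (18 * c * A + 3) * (F * G) := by positivity
  have h8 : 0 ≤ B / L * G := by positivity
  have h9 : B * (G / L) = B / L * G := by ring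
  have h10 : 9 * (c * (2 * A / L) * (B * G)) = 18 * c * A * (B / L * G) := by ring
  calc _ ≤ F * G + 9 * (c * (2 * A / L) * (B * G)) + B * (G / L) + B * (2 * (G / L)) := by
        linarith
    _ = F * G + (18 * c * A + 3) * (B / L * G) := by
        rw [h10, mul_left_comm B 2, h9]; ring
    _ ≤ (18 * c * A + 4) * (F * G) + (18 * c * A + 4) * (B / L * G) := by linarith
    _ = _ := by ring

lemma exists_bound_words {ι : Type*} [Finite ι] (n : ℕ) (F : ι → List (Fin 3) → ℝ) :
    ∃ B : ℝ, 0 < B ∧ ∀ i w, w.length ≤ n → F i w ≤ B := by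
  have hfin : ((Set.univ : Set ι) ×ˢ {w : List (Fin 3) | w.length ≤ n}).Finite :=
    Set.finite_univ.prod (List.finite_length_le _ _)
  obtain ⟨B, hB⟩ := (hfin.image fun p => F p.1 p.2).bddAbove
  exact ⟨max B 1, by positivity, fun i w hw =>
    (hB ⟨(i, w), ⟨Set.mem_univ _, hw⟩, rfl⟩).trans (le_max_left _ _)⟩

/-- Weighted Gevrey bounds for solutions of the fourth order system. -/
lemma exists_weighted_gevrey_bound (χ : Smooth) (hK : IsCompact (tsupport χ.1))
    (h0 : ∀ x, 0 ≤ χ.1 x) (h1 : ∀ x, χ.1 x ≤ 1) (a₁ a₂ : Fin 3 → Fin 3 → Smooth)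
    {c₁ c₂ : ℝ} (hc₁ : 0 < c₁) (hc₂ : 0 < c₂)
    (hell₁ : ∀ x ∈ tsupport χ.1, ∀ ξ : Fin 3 → ℝ,
      c₁ * (∑ i, ξ i ^ 2) ≤ ∑ j, ∑ k, (a₁ j k).1 x * ξ j * ξ k)
    (hell₂ : ∀ x ∈ tsupport χ.1, ∀ ξ : Fin 3 → ℝ,
      c₂ * (∑ i, ξ i ^ 2) ≤ ∑ j, ∑ k, (a₂ j k).1 x * ξ j * ξ k)
    (hs : 1 ≤ s) {A c : ℝ} (hA : 0 < A) (hc : 0 ≤ c)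
    (ha₁ : ∀ j k, GevBound (tsupport χ.1) s c A (a₁ j k))
    (ha₂ : ∀ j k, GevBound (tsupport χ.1) s c A (a₂ j k))
    {ι τ : Type*} [Fintype ι] (T : Finset τ) (wd : τ → List (Fin 3))
    (hwd : ∀ t ∈ T, (wd t).length ≤ 3) (b : τ → ι → ι → Smooth)
    (hb : ∀ t ∈ T, ∀ i j, GevBound (tsupport χ.1) s c A (b t i j)) (U : ι → Smooth)
    (heq : ∀ i w, ∀ x ∈ tsupport χ.1, (Dw w (op a₂ (op a₁ (U i)))).1 x =
      (Dw w (∑ t ∈ T, ∑ j, b t i j * Dw (wd t) (U j))).1 x) :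
    ∃ B L : ℝ, 0 < B ∧ 1 ≤ L ∧ ∀ i w,
      nrm (tsupport χ.1) (χ ^ w.length * Dw w (U i)).1 ≤ B * gev s L w.length := by
  obtain ⟨C₁, hC₁, step₁⟩ := exists_step χ hK h0 h1 a₁ hc₁ hell₁ hs hA hc ha₁
  obtain ⟨C₂, hC₂, step₂⟩ := exists_step χ hK h0 h1 a₂ hc₂ hell₂ hs hA hc ha₂
  set K := tsupport χ.1
  obtain ⟨B₁, hB₁, hUbase⟩ := exists_bound_words 3 fun (i : ι) w =>
    nrm K (χ ^ (w.length + 0) * Dw w (U i)).1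
  obtain ⟨B₂, hB₂, hZbase⟩ := exists_bound_words 1 fun (i : ι) w =>
    nrm K (χ ^ (w.length + 2) * Dw w (op a₁ (U i))).1
  set ε : ℝ := 1 / (2 * C₁) with hε
  have hε0 : 0 < ε := by positivity
  set N : ℝ := 2 * c * (T.card * Fintype.card ι : ℕ) with hN
  have hN0 : 0 ≤ N := by positivity
  set L : ℝ := 1 + 2 * A + 2 * C₁ + C₂ * (N + ε) / ε with hLdef
  have hquot : 0 ≤ C₂ * (N + ε) / ε := by positivity
  have hL1 : 1 ≤ L := by linarith
  have hAL : 2 * A ≤ L := by linarith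
  have hL : 0 < L := by linarith
  have hL₁ : C₁ / L ≤ 1 / 2 := by rw [div_le_iff₀ hL]; linarith
  have hL₂ : C₂ * (N + ε) / L ≤ ε := by
    rw [div_le_iff₀ hL, ← div_le_iff₀' hε0]; linarith
  set B : ℝ := B₁ + B₂ / ε with hB
  have hB0 : 0 < B := by positivity
  have hone : ∀ n, 1 ≤ gev s L n := fun n => by
    simpa [gev] using gev_mono hs hL1 (Nat.zero_le n)
  have key : ∀ m : ℕ, (∀ i, ∀ w : List (Fin 3), w.length ≤ m + 3 →
      nrm K (χ ^ (w.length + 0) * Dw w (U i)).1 ≤ B * gev s L (w.length + 0)) ∧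
      (∀ i, ∀ w : List (Fin 3), w.length ≤ m + 1 →
      nrm K (χ ^ (w.length + 2) * Dw w (op a₁ (U i))).1 ≤
        ε * B * gev s L (w.length + 2)) := by
    intro m
    induction m with
    | zero =>
      constructor
      · intro i w hw
        refine (hUbase i w hw).trans ?_
        have : B₁ ≤ B := le_add_of_nonneg_right (by positivity)
        exact this.trans (le_mul_of_one_le_right hB0.le (hone _))
      · intro i w hw
        refine (hZbase i w hw).trans ?_
        have : B₂ ≤ ε * B := by
          rw [hB, mul_add, mul_div_cancel₀ _ hε0.ne']
          exact le_add_of_nonneg_left (by positivity)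
        exact this.trans (le_mul_of_one_le_right (by positivity) (hone _))
    | succ m ih =>
      obtain ⟨ihU, ihZ⟩ := ih
      have hZ : ∀ i, ∀ w : List (Fin 3), w.length ≤ m + 2 →
          nrm K (χ ^ (w.length + 2) * Dw w (op a₁ (U i))).1 ≤
            ε * B * gev s L (w.length + 2) := by
        intro i w hw
        rcases hw.lt_or_eq with hw | hw
        · exact ihZ i w (by omega)
        refine (step₂ L hL1 hAL 2 m (op a₁ (U i)) (ε * B) (N * B / L) (by positivity)
          (by positivity) (ihZ i) (fun v hv => ?_) w hw).trans ?_
        · rw [nrm_congr hK (g := (χ ^ (v.length + 2 + 2) *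
            Dw v (∑ t ∈ T, ∑ j, b t i j * Dw (wd t) (U j))).1)
            fun x hx => by simp only [mul_apply, heq i v x hx], Dw_sum, Finset.mul_sum]
          have hterm : ∀ t ∈ T, ∀ j, nrm K (χ ^ (v.length + 2 + 2) *
              Dw v (b t i j * Dw (wd t) (U j))).1 ≤
              2 * c * (B * gev s L (v.length + 3)) := by
            intro t ht j
            refine (nrm_Dw_mul_le hK _ v _ _ (fun m => c * gev s A m)
              (fun m => B * gev s L (m + 3)) (fun m => mul_nonneg hc (gev_pos hA m).le)
              (fun v' _ => hb t ht i j v') (fun v' hv' => ?_)).trans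
              (binConv_gev_le hs hA hAL hc hB0.le _ _)
            have ht3 := hwd t ht
            have h2 := ihU j (wd t ++ v') (by rw [List.length_append]; omega)
            rw [List.length_append, Dw_append] at h2
            refine (nrm_pow_mul_mono hK χ h0 h1 (by omega) _).trans (h2.trans ?_)
            exact mul_le_mul_of_nonneg_left (gev_mono hs hL1 (by omega)) hB0.le
          have hsum : nrm K (∑ t ∈ T, χ ^ (v.length + 2 + 2) *
              Dw v (∑ j, b t i j * Dw (wd t) (U j)) : Smooth).1 ≤
              ∑ t ∈ T, ∑ _j : ι, 2 * c * (B * gev s L (v.length + 3)) := by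
            refine (nrm_sum hK _ _).trans (Finset.sum_le_sum fun t ht => ?_)
            rw [Dw_sum, Finset.mul_sum]
            exact (nrm_sum hK _ _).trans (Finset.sum_le_sum fun j _ => hterm t ht j)
          refine hsum.trans ?_
          have h3 := mul_gev_le hs hL (v.length + 3)
          have h4 : gev s L (v.length + 3) ≤ gev s L (v.length + 2 + 2) / L := by
            rw [le_div_iff₀ hL]
            have h5 := (gev_pos (s := s) hL (v.length + 3)).le
            refine le_trans ?_ h3
            have h6 : (0 : ℝ) ≤ ((v.length + 3 : ℕ) : ℝ) := Nat.cast_nonneg _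
            have := mul_nonneg (mul_nonneg hL.le h6) h5
            linarith
          simp only [Finset.sum_const, nsmul_eq_mul, Finset.card_univ]
          calc _ = N * B * gev s L (v.length + 3) := by rw [hN]; push_cast; ring
            _ ≤ N * B * (gev s L (v.length + 2 + 2) / L) := by gcongr
            _ = _ := by ring
        · have h2 := (gev_pos (s := s) hL (w.length + 2)).le
          calc _ = C₂ * (N + ε) / L * (B * gev s L (w.length + 2)) := by ring
            _ ≤ ε * (B * gev s L (w.length + 2)) := by gcongr
            _ = _ := by ring
      refine ⟨fun i w hw => ?_, hZ⟩
      rcases hw.lt_or_eq with hw | hw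
      · exact ihU i w (by omega)
      refine (step₁ L hL1 hAL 0 (m + 2) (U i) B (ε * B) hB0.le (by positivity) (ihU i)
        (fun v hv => hZ i v hv.le) w hw).trans ?_
      have h2 := (gev_pos (s := s) hL (w.length + 0)).le
      refine mul_le_mul_of_nonneg_right ?_ h2
      have h3 : C₁ * ε = 1 / 2 := by rw [hε]; field_simp
      calc _ = C₁ * ε * B + C₁ / L * B := by ring
        _ ≤ 1 / 2 * B + 1 / 2 * B := by rw [h3]; gcongr
        _ = B := by ring
  exact ⟨B, L, hB0, hL1, fun i w => (key w.length).1 i w (by omega)⟩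

end Smooth

open scoped Manifold Topology

namespace Smooth

variable {s : ℝ}

lemma exists_cutoff {K Ω : Set E3} (hK : IsCompact K) (hΩ : IsOpen Ω) (h : K ⊆ Ω) :
    ∃ χ : Smooth, (∀ x, 0 ≤ χ.1 x) ∧ (∀ x, χ.1 x ≤ 1) ∧
      (∃ O, IsOpen O ∧ K ⊆ O ∧ ∀ x ∈ O, χ.1 x = 1) ∧
      IsCompact (tsupport χ.1) ∧ tsupport χ.1 ⊆ Ω := by
  obtain ⟨L, hL, hKL, hLΩ⟩ := exists_compact_between hK hΩ h
  obtain ⟨f, hf1, hf0, hf⟩ :=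
    exists_contMDiffMap_one_nhds_of_subset_interior (n := ⊤) 𝓘(ℝ, E3) hK.isClosed hKL
  obtain ⟨O, hO, hKO, hO1⟩ := (eventually_nhdsSet_iff_exists).1 hf1
  have hsupp : tsupport f ⊆ L := closure_minimal
    (fun x hx => by_contra fun h => hx (hf0 x h)) hL.isClosed
  exact ⟨⟨f, f.contMDiff.contDiff⟩, fun x => (hf x).1, fun x => (hf x).2, ⟨O, hO, hKO, hO1⟩,
    hL.of_isClosed_subset (isClosed_tsupport _) hsupp, hsupp.trans hLΩ⟩

lemma exists_extension {K Ω : Set E3} (hK : IsCompact K) (hΩ : IsOpen Ω) (h : K ⊆ Ω) :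
    ∃ O, IsOpen O ∧ K ⊆ O ∧ O ⊆ Ω ∧
      ∀ f : E3 → ℝ, ContDiffOn ℝ ∞ f Ω → ∃ g : Smooth, Set.EqOn g.1 f O := by
  obtain ⟨θ, -, -, ⟨O, hO, hKO, hO1⟩, -, hθ⟩ := exists_cutoff hK hΩ h
  refine ⟨O ∩ Ω, hO.inter hΩ, Set.subset_inter hKO h, Set.inter_subset_right, fun f hf => ?_⟩
  have hg : ContDiff ℝ ∞ fun x => θ.1 x * f x := contDiff_iff_contDiffAt.2 fun x => by
    by_cases hx : x ∈ Ω
    · exact θ.contDiff.contDiffAt.mul (hf.contDiffAt (hΩ.mem_nhds hx))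
    · have h0 : θ.1 =ᶠ[𝓝 x] 0 := notMem_tsupport_iff_eventuallyEq.1 fun h => hx (hθ h)
      refine (contDiffAt_const (c := (0 : ℝ))).congr_of_eventuallyEq ?_
      filter_upwards [h0] with y hy
      simp [hy]
  exact ⟨⟨_, hg⟩, fun x hx => by simp [hO1 x hx.1]⟩

lemma GevBound.mono {K : Set E3} {c c' A A' : ℝ} {f : Smooth} (h : GevBound K s c A f)
    (hc : 0 ≤ c) (hA : 0 ≤ A) (hcc : c ≤ c') (hAA : A ≤ A') : GevBound K s c' A' f := by
  intro w x hx
  refine (h w x hx).trans ?_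
  unfold gev
  have := hc.trans hcc
  gcongr

lemma exists_common_gevBound {K : Set E3} {ι : Type*} [Finite ι] (F : ι → Smooth)
    (h : ∀ i, ∃ c > 0, ∃ A > 0, GevBound K s c A (F i)) :
    ∃ c > 0, ∃ A > 0, ∀ i, GevBound K s c A (F i) := by
  have := Fintype.ofFinite ι
  choose c hc A hA hF using h
  refine ⟨1 + ∑ i, c i, by linarith [Finset.sum_nonneg fun i (_ : i ∈ univ) => (hc i).le],
    1 + ∑ i, A i, by linarith [Finset.sum_nonneg fun i (_ : i ∈ univ) => (hA i).le], fun i => ?_⟩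
  have h1 := Finset.single_le_sum (fun i _ => (hc i).le) (Finset.mem_univ i)
  have h2 := Finset.single_le_sum (fun i _ => (hA i).le) (Finset.mem_univ i)
  exact (hF i).mono (hc i).le (hA i).le (by linarith) (by linarith)

lemma exists_gevBound {Ω O K : Set E3} (hO : IsOpen O) (hOΩ : O ⊆ Ω) (hKO : K ⊆ O)
    {f : E3 → ℝ} (hf : GevreyOn s Ω f) {g : Smooth} (hg : Set.EqOn g.1 f O) :
    ∃ c > 0, ∃ A > 0, GevBound K s c A g := by
  obtain ⟨-, c, hc, A, hA, h⟩ := hf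
  refine ⟨c, hc, A, hA, fun w x hx => ?_⟩
  obtain ⟨β, hβ, hD⟩ := exists_Dw_eq_mpd w
  rw [hD, mpd_eqOn hO hg β (hKO hx), ← hβ, gev, ← mul_assoc]
  exact h β x (hOΩ (hKO hx))

lemma op_eqOn {O : Set E3} (hO : IsOpen O) {a : Fin 3 → Fin 3 → Smooth}
    {a' : Fin 3 → Fin 3 → E3 → ℝ} (ha : ∀ j k, Set.EqOn (a j k).1 (a' j k) O) {u : Smooth}
    {f : E3 → ℝ} (hu : Set.EqOn u.1 f O) : Set.EqOn (op a u).1 (op2 a' f) O := by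
  intro x hx
  simp only [op, op2, sum_apply, mul_apply, D_val]
  refine Finset.sum_congr rfl fun j _ => Finset.sum_congr rfl fun k _ => ?_
  rw [ha j k hx, pd_eqOn hO (pd_eqOn hO hu k) j hx]

lemma gev_add_three_le (hs : 1 ≤ s) {L : ℝ} (hL : 0 < L) (k : ℕ) :
    gev s L (k + 3) ≤ L ^ 3 * 48 ^ s * gev s (L * 2 ^ s) k := by
  have h1 : (k + 3).factorial ≤ 48 * (2 ^ k * k.factorial) := by
    have h2 := Nat.choose_mul_factorial_mul_factorial (show 3 ≤ k + 3 by omega)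
    rw [Nat.add_sub_cancel, show (3 : ℕ).factorial = 6 from rfl] at h2
    have h3 := Nat.choose_le_two_pow (k + 3) 3
    rw [pow_add] at h3
    rw [← h2]
    calc _ ≤ 2 ^ k * 2 ^ 3 * 6 * k.factorial := by gcongr
      _ = _ := by ring
  have h4 : ((k + 3).factorial : ℝ) ^ s ≤ 48 ^ s * ((2 ^ s) ^ k * (k.factorial : ℝ) ^ s) := by
    have h5 : ((k + 3).factorial : ℝ) ≤ 48 * (2 ^ k * k.factorial) := by exact_mod_cast h1
    calc _ ≤ (48 * (2 ^ k * (k.factorial : ℝ))) ^ s := by gcongr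
      _ = _ := by
        rw [Real.mul_rpow (by positivity) (by positivity),
          Real.mul_rpow (by positivity) (by positivity), ← Real.rpow_natCast, ← Real.rpow_natCast,
          ← Real.rpow_mul (by positivity), ← Real.rpow_mul (by positivity), mul_comm s]
  unfold gev
  calc _ ≤ L ^ (k + 3) * (48 ^ s * ((2 ^ s) ^ k * (k.factorial : ℝ) ^ s)) := by gcongr
    _ = _ := by ring

/-- Pointwise Gevrey bounds from weighted `L²` ones. -/
lemma exists_sup_bound (hs : 1 ≤ s) (χ χ₁ : Smooth) (hK : IsCompact (tsupport χ.1))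
    (h0 : ∀ x, 0 ≤ χ.1 x) (h1 : ∀ x, χ.1 x ≤ 1) (hχ₁ : tsupport χ₁.1 ⊆ tsupport χ.1)
    (hχ : ∀ x ∈ tsupport χ₁.1, χ.1 x = 1) (u : Smooth) {B L : ℝ} (hB : 0 < B) (hL : 1 ≤ L)
    (hu : ∀ w : List (Fin 3),
      nrm (tsupport χ.1) (χ ^ w.length * Dw w u).1 ≤ B * gev s L w.length) :
    ∃ c > 0, ∃ A > 0, ∀ w x, |(χ₁ * Dw w u).1 x| ≤ c * gev s A w.length := by
  have hfin : Finite {v : List (Fin 3) // v.length ≤ 3} := List.finite_length_le _ _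
  obtain ⟨M, hM1, hM⟩ := exists_bound hK fun v : {v : List (Fin 3) // v.length ≤ 3} => Dw v.1 χ₁
  set K := tsupport χ.1
  set I := nrm K fun _ => 1
  have hI : 0 ≤ I := nrm_nonneg _
  refine ⟨(I + 1) * (8 * M * B) * (L ^ 3 * 48 ^ s), by positivity, L * 2 ^ s, by positivity,
    fun w x => ?_⟩
  set k := w.length
  set f := χ₁ * Dw w u with hf
  have hsupp : tsupport f.1 ⊆ tsupport χ₁.1 := tsupport_mul_left _ _
  refine (abs_le_nrm hK f (hsupp.trans hχ₁) x).trans ?_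
  have hg : tsupport (D 2 (D 1 (D 0 f))).1 ⊆ tsupport χ₁.1 :=
    (((tsupport_D _ _).trans (tsupport_D _ _)).trans (tsupport_D _ _)).trans hsupp
  have heq : nrm K (D 2 (D 1 (D 0 f))).1 = nrm K (χ ^ (k + 3) * Dw [0, 1, 2] f).1 := by
    refine nrm_congr hK fun x _ => ?_
    change (D 2 (D 1 (D 0 f))).1 x = χ.1 x ^ (k + 3) * (D 2 (D 1 (D 0 f))).1 x
    by_cases hx : x ∈ tsupport χ₁.1
    · rw [hχ x hx, one_pow, one_mul]
    · rw [image_eq_zero_of_notMem_tsupport fun h => hx (hg h), mul_zero]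
  have hG := (gev_pos (s := s) (L := L) (by linarith) (k + 3)).le
  have hleib : nrm K (χ ^ (k + 3) * Dw [0, 1, 2] f).1 ≤
      binConv 3 (fun _ => M) (fun _ => B * gev s L (k + 3)) := by
    refine nrm_Dw_mul_le hK _ [0, 1, 2] χ₁ (Dw w u) _ _ (fun _ => by linarith)
      (fun v hv => hM ⟨v, hv⟩) fun v hv => ?_
    have hv : v.length ≤ 3 := hv
    have h2 := hu (w ++ v)
    rw [List.length_append, Dw_append] at h2
    exact (nrm_pow_mul_mono hK χ h0 h1 (by omega) _).trans
      (h2.trans (mul_le_mul_of_nonneg_left (gev_mono hs hL (by omega)) hB.le))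
  have hbin : binConv 3 (fun _ => M) (fun _ => B * gev s L (k + 3)) =
      8 * M * B * gev s L (k + 3) := by
    simp only [binConv_succ, binConv_zero]
    ring
  rw [heq]
  have h3 := gev_add_three_le hs (show 0 < L by linarith) k
  rw [hbin] at hleib
  calc _ ≤ (I + 1) * (8 * M * B * gev s L (k + 3)) := by
        gcongr
        · exact nrm_nonneg _
        · linarith
    _ ≤ (I + 1) * (8 * M * B * (L ^ 3 * 48 ^ s * gev s (L * 2 ^ s) k)) := by gcongr
    _ = _ := by ring

end Smooth

/-- **Gevrey elliptic regularity for the fourth-order system** (Lemma 5.3).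
If `U` is a smooth solution of `P₂P₁U = Σ_{|β|≤3} a_β ∂^β U` in `Ω`, where
`P₁, P₂` are uniformly elliptic with `G^s(Ω)` coefficients and the `a_β` are
`G^s(Ω)` matrix-valued, then each component of `U` is in `G^s(V)` for every
bounded open `V` with `closure V ⊆ Ω`. -/
theorem gevrey_elliptic_regularity
    (Ω : Set E3) (hΩopen : IsOpen Ω)
    (s : ℝ) (hs : 1 ≤ s)
    (a : Fin 2 → Fin 3 → Fin 3 → E3 → ℝ)
    (hsym : ∀ ℓ : Fin 2, ∀ j k : Fin 3, ∀ x ∈ Ω, a ℓ j k x = a ℓ k j x)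
    (hG : ∀ ℓ : Fin 2, ∀ j k : Fin 3, GevreyOn s Ω (a ℓ j k))
    (hell : ∀ ℓ : Fin 2, UnifElliptic (a ℓ) Ω)
    (aβ : (Fin 3 → ℕ) → E3 → Fin 7 → Fin 7 → ℝ)
    (hGaβ : ∀ β : Fin 3 → ℕ, mdeg β ≤ 3 → ∀ i j : Fin 7, GevreyOn s Ω (fun x => aβ β x i j))
    (U : E3 → Fin 7 → ℝ) (hU : ∀ i : Fin 7, ContDiffOn ℝ (⊤ : ℕ∞) (fun x => U x i) Ω)
    (hsol : ∀ x ∈ Ω, ∀ i : Fin 7,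
      op2 (a 1) (op2 (a 0) (fun y => U y i)) x = lowOrd aβ U x i) :
    ∀ V : Set E3, IsOpen V → Bornology.IsBounded V → closure V ⊆ Ω →
      ∀ i : Fin 7, GevreyOn s V (fun x => U x i) := by
  intro V hV hVb hVΩ
  have hVc : IsCompact (closure V) := hVb.isCompact_closure
  obtain ⟨χ₁, -, -, ⟨O₁, -, hVO₁, hχ₁1⟩, hχ₁c, hχ₁Ω⟩ := Smooth.exists_cutoff hVc hΩopen hVΩ
  obtain ⟨χ, h0, h1, ⟨O₂, -, hχ₁O₂, hχ1⟩, hK, hKΩ⟩ := Smooth.exists_cutoff hχ₁c hΩopen hχ₁Ω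
  have hχ : ∀ x ∈ tsupport χ₁.1, χ.1 x = 1 := fun x hx => hχ1 x (hχ₁O₂ hx)
  have hχ₁χ : tsupport χ₁.1 ⊆ tsupport χ.1 := fun x hx =>
    subset_tsupport _ (by simp [hχ x hx])
  obtain ⟨O, hO, hKO, hOΩ, hext⟩ := Smooth.exists_extension hK hΩopen hKΩ
  let T : Finset (Fin 3 → Fin 4) :=
    Finset.univ.filter fun β : Fin 3 → Fin 4 => mdeg (fun k => (β k : ℕ)) ≤ 3
  choose u hu using fun i => hext _ (hU i)
  have ha : ∀ p : Fin 2 × Fin 3 × Fin 3, ∃ g : Smooth, Set.EqOn g.1 (a p.1 p.2.1 p.2.2) O ∧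
      ∃ c > 0, ∃ A > 0, Smooth.GevBound (tsupport χ.1) s c A g := fun p => by
    obtain ⟨g, hg⟩ := hext _ (hG p.1 p.2.1 p.2.2).1
    exact ⟨g, hg, Smooth.exists_gevBound hO hOΩ hKO (hG p.1 p.2.1 p.2.2) hg⟩
  have hb : ∀ p : T × Fin 7 × Fin 7, ∃ g : Smooth,
      Set.EqOn g.1 (fun x => aβ (fun k => (p.1.1 k : ℕ)) x p.2.1 p.2.2) O ∧
      ∃ c > 0, ∃ A > 0, Smooth.GevBound (tsupport χ.1) s c A g := fun p => by
    have hp := hGaβ _ (Finset.mem_filter.1 p.1.2).2 p.2.1 p.2.2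
    obtain ⟨g, hg⟩ := hext _ hp.1
    exact ⟨g, hg, Smooth.exists_gevBound hO hOΩ hKO hp hg⟩
  choose a' ha' ha'G using ha
  choose b hb' hbG using hb
  obtain ⟨c₁, hc₁, A₁, hA₁, hG₁⟩ := Smooth.exists_common_gevBound a' ha'G
  obtain ⟨c₂, hc₂, A₂, hA₂, hG₂⟩ := Smooth.exists_common_gevBound b hbG
  obtain ⟨e₁, he₁, hell₁⟩ := hell 0
  obtain ⟨e₂, he₂, hell₂⟩ := hell 1
  have hell' : ∀ (ℓ : Fin 2) (e : ℝ), (∀ x ∈ Ω, ∀ ξ : Fin 3 → ℝ,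
      e * (∑ i, ξ i ^ 2) ≤ ∑ j, ∑ k, a ℓ j k x * ξ j * ξ k) →
      ∀ x ∈ tsupport χ.1, ∀ ξ : Fin 3 → ℝ,
      e * (∑ i, ξ i ^ 2) ≤ ∑ j, ∑ k, (a' (ℓ, j, k)).1 x * ξ j * ξ k := by
    intro ℓ e h x hx ξ
    refine (h x (hKΩ hx) ξ).trans_eq ?_
    refine Finset.sum_congr rfl fun j _ => Finset.sum_congr rfl fun k _ => ?_
    rw [ha' (ℓ, j, k) (hKO hx)]
  have hc : 0 ≤ c₁ + c₂ := by positivity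
  have hA : 0 < A₁ + A₂ := by positivity
  have hGa : ∀ p, Smooth.GevBound (tsupport χ.1) s (c₁ + c₂) (A₁ + A₂) (a' p) := fun p =>
    (hG₁ p).mono hc₁.le hA₁.le (by linarith) (by linarith)
  have heq : ∀ i w, ∀ x ∈ tsupport χ.1,
      (Smooth.Dw w (Smooth.op (fun j k => a' (1, j, k))
        (Smooth.op (fun j k => a' (0, j, k)) (u i)))).1 x =
      (Smooth.Dw w (∑ t : T, ∑ j, b (t, i, j) *
        Smooth.Dw (Smooth.word fun k => (t.1 k : ℕ)) (u j))).1 x := by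
    intro i w x hx
    refine Smooth.Dw_eqOn hO (fun y hy => ?_) w (hKO hx)
    rw [Smooth.op_eqOn hO (fun j k => ha' (1, j, k))
      (Smooth.op_eqOn hO (fun j k => ha' (0, j, k)) (hu i)) hy]
    refine (hsol y (hOΩ hy) i).trans ?_
    simp only [lowOrd, Smooth.sum_apply, Smooth.mul_apply]
    rw [← Finset.sum_coe_sort]
    refine Finset.sum_congr rfl fun t _ => Finset.sum_congr rfl fun j _ => ?_
    rw [hb' (t, i, j) hy, Smooth.Dw_word, Smooth.mpd_eqOn hO (hu j) _ hy]
  obtain ⟨B, L, hB, hL, hbound⟩ := Smooth.exists_weighted_gevrey_bound χ hK h0 h1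
    (fun j k => a' (0, j, k)) (fun j k => a' (1, j, k)) he₁ he₂ (hell' 0 e₁ hell₁)
    (hell' 1 e₂ hell₂) hs hA hc (fun j k => hGa _) (fun j k => hGa _) (Finset.univ : Finset T)
    (fun t => Smooth.word fun k => (t.1 k : ℕ))
    (fun t _ => (Smooth.length_word _).trans_le (Finset.mem_filter.1 t.2).2)
    (fun t i j => b (t, i, j))
    (fun t _ i j => (hG₂ _).mono hc₂.le hA₂.le (by linarith) (by linarith)) u heq
  intro i
  refine ⟨(hU i).mono (subset_closure.trans hVΩ), ?_⟩
  obtain ⟨c, hc, A, hA, h⟩ :=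
    Smooth.exists_sup_bound hs χ χ₁ hK h0 h1 hχ₁χ hχ (u i) hB hL (hbound i)
  refine ⟨c, hc, A, hA, fun β x hx => ?_⟩
  have hx1 : χ₁.1 x = 1 := hχ₁1 x (hVO₁ (subset_closure hx))
  have hxO : x ∈ O := hKO (hχ₁χ (subset_tsupport _ (by simp [hx1])))
  have h2 := h (Smooth.word β) x
  rw [Smooth.mul_apply, hx1, one_mul, Smooth.Dw_word, Smooth.length_word,
    Smooth.mpd_eqOn hO (hu i) β hxO, gev, ← mul_assoc] at h2
  exact h2
end
end

section
/- Let Ω ⊂ ℝ³ be open, with λ, μ, ρ, t_jk ∈ C^∞(Ω), ρ > 0, T = (t_jk) symmetric and ∇·T = 0. Define R f = Σ_{j,k} t_jk ∂²_{jk} f, P₁ = R + μΔ and P₂ = R + (λ+2μ)Δ. If u : Ω → ℝ³ is a smooth solution of the residual stress system ∇·σ + κ²ρu = 0, then with v = ∇·u and w = ∇×u there exist smooth coefficient functions, depending only on λ, μ, ρ, T and κ (not on u), such that in Ω: (i) P₁u = Σ_{|β|≤1} c¹_β ∂^β(u,v); (ii) P₂v = −Σ_{j,k} ∇t_jk ·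 ∂²_{jk}u + Σ_{|β|≤1} c²_β ∂^β(u,v,w); (iii) P₁w = −Σ_{j,k} ∇t_jk × ∂²_{jk}u + Σ_{|β|≤1} c³_β ∂^β(u,v,w), where each c^i_β is a smooth matrix-valued function of the appropriate size. -/
open MeasureTheory Metric Finset

noncomputable section

/-- The operator `R f = Σ_{j,k} t_jk ∂²_{jk} f`. -/
def Rop (t : Fin 3 → Fin 3 → E3 → ℝ) (f : E3 → ℝ) (x : E3) : ℝ :=
  ∑ j, ∑ k, t j k x * pd j (pd k f) x

/-- The Laplacian `Δ f`. -/
def lap (f : E3 → ℝ) (x : E3) : ℝ := ∑ j, pd j (pd j f) x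

/-- The cross product of two vectors in `ℝ³`. -/
def cross (A B : Fin 3 → ℝ) : Fin 3 → ℝ :=
  ![A 1 * B 2 - A 2 * B 1, A 2 * B 0 - A 0 * B 2, A 0 * B 1 - A 1 * B 0]

/-- The pair `(u, v) = (u, ∇·u) : Ω → ℝ⁴`. -/
def uvPair (u : E3 → Fin 3 → ℝ) : E3 → Fin 4 → ℝ :=
  fun x => ![u x 0, u x 1, u x 2, divg u x]

/-- A scalar operator `L` on vector fields that is, on `Ω`, a linear differential operator of order
at most one with smooth coefficients. -/
def IsFirstOrderOn {n : ℕ} (Ω : Set E3) (L : (E3 → Fin n → ℝ) → E3 → ℝ) : Prop :=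
  ∃ c : (Fin 3 → ℕ) → E3 → Fin n → ℝ,
    (∀ β j, ContDiffOn ℝ (⊤ : ℕ∞) (fun x => c β x j) Ω) ∧
    ∀ U x, x ∈ Ω → L U x =
      ∑ β ∈ Finset.univ.filter (fun β : Fin 3 → Fin 2 => mdeg (fun k => (β k : ℕ)) ≤ 1),
        ∑ j, c (fun k => (β k : ℕ)) x j * mpd (fun k => (β k : ℕ)) (fun y => U y j) x

namespace IsFirstOrderOn

variable {n : ℕ} {Ω : Set E3} {L M : (E3 → Fin n → ℝ) → E3 → ℝ}

theorem add (hL : IsFirstOrderOn Ω L) (hM : IsFirstOrderOn Ω M) :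
    IsFirstOrderOn Ω (fun U x => L U x + M U x) := by
  obtain ⟨c, hc, hcL⟩ := hL
  obtain ⟨d, hd, hdM⟩ := hM
  refine ⟨fun β x j => c β x j + d β x j, fun β j => (hc β j).add (hd β j), fun U x hx => ?_⟩
  simp only [hcL U x hx, hdM U x hx, add_mul, sum_add_distrib]

theorem mul {a : E3 → ℝ} (ha : ContDiffOn ℝ (⊤ : ℕ∞) a Ω) (hL : IsFirstOrderOn Ω L) :
    IsFirstOrderOn Ω (fun U x => a x * L U x) := by
  obtain ⟨c, hc, hcL⟩ := hL
  refine ⟨fun β x j => a x * c β x j, fun β j => ha.mul (hc β j), fun U x hx => ?_⟩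
  simp only [hcL U x hx, mul_sum, mul_assoc]

theorem neg (hL : IsFirstOrderOn Ω L) : IsFirstOrderOn Ω (fun U x => -L U x) := by
  simpa using (mul (a := fun _ => -1) contDiffOn_const hL)

theorem sub (hL : IsFirstOrderOn Ω L) (hM : IsFirstOrderOn Ω M) :
    IsFirstOrderOn Ω (fun U x => L U x - M U x) := by
  simpa only [sub_eq_add_neg] using hL.add hM.neg

theorem zero : IsFirstOrderOn Ω (fun (_ : E3 → Fin n → ℝ) _ => 0) :=
  ⟨fun _ _ _ => 0, fun _ _ => contDiffOn_const, fun U x _ => by simp⟩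

theorem sum {ι : Type*} (s : Finset ι) {L : ι → (E3 → Fin n → ℝ) → E3 → ℝ}
    (hL : ∀ i, IsFirstOrderOn Ω (L i)) : IsFirstOrderOn Ω (fun U x => ∑ i ∈ s, L i U x) := by
  classical
  induction s using Finset.induction_on with
  | empty => simpa using zero
  | insert i s hi ih => simpa only [sum_insert hi] using (hL i).add ih

theorem mpd (j : Fin n) (β : Fin 3 → Fin 2) (hβ : mdeg (fun k => (β k : ℕ)) ≤ 1) :
    IsFirstOrderOn Ω (fun U x => mpd (fun k => (β k : ℕ)) (fun y => U y j) x) := by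
  refine ⟨fun γ _ i => if γ = (fun k => (β k : ℕ)) ∧ i = j then 1 else 0,
    fun _ _ => contDiffOn_const, fun U x _ => ?_⟩
  rw [sum_eq_single β, sum_eq_single j]
  · simp
  · intro i _ hi
    simp [hi]
  · simp
  · intro γ _ hγ
    have : (fun k => (γ k : ℕ)) ≠ fun k => (β k : ℕ) := fun h =>
      hγ (funext fun k => Fin.ext (congrFun h k))
    simp [this]
  · simp [hβ]

theorem apply (j : Fin n) : IsFirstOrderOn Ω (fun U x => U x j) :=
  mpd j 0 (by decide)

theorem pd (j : Fin n) (m : Fin 3) : IsFirstOrderOn Ω (fun U x => pd m (fun y => U y j) x) := by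
  fin_cases m
  · exact mpd j ![1, 0, 0] (by decide)
  · exact mpd j ![0, 1, 0] (by decide)
  · exact mpd j ![0, 0, 1] (by decide)

theorem curl (σ : Fin 3 → Fin n) (i : Fin 3) :
    IsFirstOrderOn Ω (fun U x => curl (fun y k => U y (σ k)) x i) := by
  fin_cases i
  exacts [(pd _ _).sub (pd _ _), (pd _ _).sub (pd _ _), (pd _ _).sub (pd _ _)]

end IsFirstOrderOn

section PartialDerivatives

variable {Ω : Set E3} {f g : E3 → ℝ} {x : E3}

theorem pd_add (i : Fin 3) (hf : DifferentiableAt ℝ f x) (hg : DifferentiableAt ℝ g x) :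
    pd i (fun y => f y + g y) x = pd i f x + pd i g x := by
  simp [pd, fderiv_fun_add hf hg]

theorem pd_sub (i : Fin 3) (hf : DifferentiableAt ℝ f x) (hg : DifferentiableAt ℝ g x) :
    pd i (fun y => f y - g y) x = pd i f x - pd i g x := by
  simp [pd, fderiv_fun_sub hf hg]

theorem pd_mul (i : Fin 3) (hf : DifferentiableAt ℝ f x) (hg : DifferentiableAt ℝ g x) :
    pd i (fun y => f y * g y) x = pd i f x * g x + f x * pd i g x := by
  simp [pd, fderiv_fun_mul hf hg]
  ring

theorem pd_const_mul (i : Fin 3) (c : ℝ) (hf : DifferentiableAt ℝ f x) :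
    pd i (fun y => c * f y) x = c * pd i f x := by
  simp [pd, fderiv_const_mul hf]

theorem pd_sum {ι : Type*} (s : Finset ι) {F : ι → E3 → ℝ} (i : Fin 3)
    (hF : ∀ a, DifferentiableAt ℝ (F a) x) :
    pd i (fun y => ∑ a ∈ s, F a y) x = ∑ a ∈ s, pd i (F a) x := by
  simp [pd, fderiv_fun_sum fun a _ => hF a]

theorem pd_congr (hΩ : IsOpen Ω) (hfg : ∀ y ∈ Ω, f y = g y) (hx : x ∈ Ω) (i : Fin 3) :
    pd i f x = pd i g x := by
  have : f =ᶠ[nhds x] g := Filter.eventually_of_mem (hΩ.mem_nhds hx) hfg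
  simp [pd, this.fderiv_eq]

theorem ContDiffOn.pd (hΩ : IsOpen Ω) (hf : ContDiffOn ℝ (⊤ : ℕ∞) f Ω) (i : Fin 3) :
    ContDiffOn ℝ (⊤ : ℕ∞) (pd i f) Ω :=
  (hf.fderiv_of_isOpen hΩ (by simp)).clm_apply contDiffOn_const

theorem ContDiffOn.differentiableAt_of_isOpen (hΩ : IsOpen Ω) (hf : ContDiffOn ℝ (⊤ : ℕ∞) f Ω)
    (hx : x ∈ Ω) : DifferentiableAt ℝ f x :=
  (hf.contDiffAt (hΩ.mem_nhds hx)).differentiableAt (by simp)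

theorem pd_comm (hΩ : IsOpen Ω) (hf : ContDiffOn ℝ (⊤ : ℕ∞) f Ω) (hx : x ∈ Ω) (i j : Fin 3) :
    pd i (pd j f) x = pd j (pd i f) x := by
  have hd : DifferentiableAt ℝ (fderiv ℝ f) x :=
    ((hf.fderiv_of_isOpen hΩ (m := (⊤ : ℕ∞)) (by simp)).contDiffAt
      (hΩ.mem_nhds hx)).differentiableAt (by simp)
  have h (a b : E3) :
      fderiv ℝ (fun y => fderiv ℝ f y a) x b = fderiv ℝ (fderiv ℝ f) x b a := by
    rw [fderiv_clm_apply hd (differentiableAt_const a)]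
    simp
  have hs : IsSymmSndFDerivAt ℝ f x :=
    (hf.contDiffAt (hΩ.mem_nhds hx)).isSymmSndFDerivAt (by
      rw [minSmoothness_of_isRCLikeNormedField]
      exact WithTop.coe_le_coe.2 le_top)
  unfold _root_.pd
  rw [h, h]
  exact hs _ _

theorem pd_Rop (hΩ : IsOpen Ω) {a : Fin 3 → Fin 3 → E3 → ℝ}
    (ha : ∀ j k, ContDiffOn ℝ (⊤ : ℕ∞) (a j k) Ω) (hf : ContDiffOn ℝ (⊤ : ℕ∞) f Ω)
    (hx : x ∈ Ω) (m : Fin 3) :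
    pd m (Rop a f) x = Rop (fun j k => pd m (a j k)) f x + Rop a (pd m f) x := by
  have had j k := (ha j k).differentiableAt_of_isOpen hΩ hx
  have hfd j k := ((hf.pd hΩ k).pd hΩ j).differentiableAt_of_isOpen hΩ hx
  have hcomm j k : pd m (pd j (pd k f)) x = pd j (pd k (pd m f)) x := by
    rw [pd_comm hΩ (hf.pd hΩ k) hx]
    exact pd_congr hΩ (fun y hy => pd_comm hΩ hf hy m k) hx j
  unfold Rop
  rw [pd_sum _ _ fun j => by
    exact DifferentiableAt.fun_sum fun k _ => (had j k).fun_mul (hfd j k)]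
  simp only [← sum_add_distrib]
  refine sum_congr rfl fun j _ => ?_
  rw [pd_sum _ _ fun k => (had j k).fun_mul (hfd j k)]
  refine sum_congr rfl fun k _ => ?_
  rw [pd_mul _ (had j k) (hfd j k), hcomm]

theorem Rop_sum (hΩ : IsOpen Ω) (a : Fin 3 → Fin 3 → E3 → ℝ) {ι : Type*} (s : Finset ι)
    {F : ι → E3 → ℝ} (hF : ∀ i, ContDiffOn ℝ (⊤ : ℕ∞) (F i) Ω) (hx : x ∈ Ω) :
    Rop a (fun y => ∑ i ∈ s, F i y) x = ∑ i ∈ s, Rop a (F i) x := by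
  have h j k : pd j (pd k fun y => ∑ i ∈ s, F i y) x = ∑ i ∈ s, pd j (pd k (F i)) x := by
    rw [← pd_sum _ _ fun i => ((hF i).pd hΩ k).differentiableAt_of_isOpen hΩ hx]
    exact pd_congr hΩ (fun y hy => pd_sum _ _ fun i =>
      (hF i).differentiableAt_of_isOpen hΩ hy) hx j
  simp only [Rop, h, mul_sum]
  rw [sum_comm]
  conv_rhs => rw [sum_comm]
  rw [sum_comm]
  exact sum_congr rfl fun j _ => sum_comm

theorem Rop_sub (hΩ : IsOpen Ω) (a : Fin 3 → Fin 3 → E3 → ℝ)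
    (hf : ContDiffOn ℝ (⊤ : ℕ∞) f Ω) (hg : ContDiffOn ℝ (⊤ : ℕ∞) g Ω) (hx : x ∈ Ω) :
    Rop a (fun y => f y - g y) x = Rop a f x - Rop a g x := by
  have h j k : pd j (pd k fun y => f y - g y) x = pd j (pd k f) x - pd j (pd k g) x := by
    rw [← pd_sub _ ((hf.pd hΩ k).differentiableAt_of_isOpen hΩ hx)
      ((hg.pd hΩ k).differentiableAt_of_isOpen hΩ hx)]
    exact pd_congr hΩ (fun y hy => pd_sub _ (hf.differentiableAt_of_isOpen hΩ hy)
      (hg.differentiableAt_of_isOpen hΩ hy)) hx j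
  simp only [Rop, h, mul_sub, sum_sub_distrib]

theorem Rop_a1coef (t : Fin 3 → Fin 3 → E3 → ℝ) (mu f : E3 → ℝ) (x : E3) :
    Rop (a1coef t mu) f x = Rop t f x + mu x * lap f x := by
  simp only [Rop, a1coef, lap, Fin.sum_univ_three]
  simp
  ring

theorem ContDiffOn.a1coef {t : Fin 3 → Fin 3 → E3 → ℝ} {mu : E3 → ℝ}
    (ht : ∀ j k, ContDiffOn ℝ (⊤ : ℕ∞) (t j k) Ω) (hmu : ContDiffOn ℝ (⊤ : ℕ∞) mu Ω)
    (j k : Fin 3) : ContDiffOn ℝ (⊤ : ℕ∞) (a1coef t mu j k) Ω :=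
  (hmu.mul contDiffOn_const).add (ht j k)

theorem pd_a1coef (hΩ : IsOpen Ω) {t : Fin 3 → Fin 3 → E3 → ℝ} {mu : E3 → ℝ}
    (ht : ∀ j k, ContDiffOn ℝ (⊤ : ℕ∞) (t j k) Ω) (hmu : ContDiffOn ℝ (⊤ : ℕ∞) mu Ω)
    (hx : x ∈ Ω) (m j k : Fin 3) :
    pd m (a1coef t mu j k) x = a1coef (fun j k => pd m (t j k)) (pd m mu) j k x := by
  have htd := (ht j k).differentiableAt_of_isOpen hΩ hx
  have hmd := hmu.differentiableAt_of_isOpen hΩ hx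
  unfold a1coef
  split_ifs
  · simpa using pd_add m hmd htd
  · simp

end PartialDerivatives

/-- The first-order terms, in `(u, v)`, of component `i` of the residual stress system when
`v = ∇·u`. -/
def lowerTerms (lam mu rho : E3 → ℝ) (κ : ℝ) (u : E3 → Fin 3 → ℝ) (v : E3 → ℝ) (i : Fin 3)
    (x : E3) : ℝ :=
  (lam x + mu x) * pd i v x + pd i lam x * v x
    + (∑ j, pd j mu x * (pd j (fun y => u y i) x + pd i (fun y => u y j) x))
    + κ ^ 2 * (rho x * u x i)

/-- The first-order terms, in `(u, v, w)`, of the divergence of the residual stress system when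
`v = ∇·u` and `w = ∇×u`. -/
def divLowerTerms (lam mu rho : E3 → ℝ) (κ : ℝ) (u : E3 → Fin 3 → ℝ) (v : E3 → ℝ)
    (w : E3 → Fin 3 → ℝ) (x : E3) : ℝ :=
  (∑ i, (2 * pd i mu x * (pd i v x - curl w x i) + (2 * pd i lam x + 2 * pd i mu x) * pd i v x
      + pd i (pd i lam) x * v x
      + (∑ j, pd i (pd j mu) x * (pd j (fun y => u y i) x + pd i (fun y => u y j) x))
      + κ ^ 2 * pd i rho x * u x i))
    + κ ^ 2 * rho x * v x

/-- The first-order terms, in `(u, v, w)`, of component `i` of the curl of the residual stress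
system when `v = ∇·u` and `w = ∇×u`. -/
def curlLowerTerms (mu rho : E3 → ℝ) (κ : ℝ) (u : E3 → Fin 3 → ℝ) (v : E3 → ℝ)
    (w : E3 → Fin 3 → ℝ) (i : Fin 3) (x : E3) : ℝ :=
  pd (i + 1) mu x * (pd (i + 2) v x - curl w x (i + 2))
    - pd (i + 2) mu x * (pd (i + 1) v x - curl w x (i + 1))
    + pd (i + 1) mu x * pd (i + 2) v x - pd (i + 2) mu x * pd (i + 1) v x
    + (∑ j, (pd (i + 1) (pd j mu) x * (pd j (fun y => u y (i + 2)) x + pd (i + 2) (fun y => u y j) x)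
      - pd (i + 2) (pd j mu) x * (pd j (fun y => u y (i + 1)) x + pd (i + 1) (fun y => u y j) x)
      + pd j mu x * pd j (fun y => w y i) x))
    + κ ^ 2 * pd (i + 1) rho x * u x (i + 2) - κ ^ 2 * pd (i + 2) rho x * u x (i + 1)
    + κ ^ 2 * rho x * w x i

theorem curl_apply (u : E3 → Fin 3 → ℝ) (x : E3) (i : Fin 3) :
    curl u x i = pd (i + 1) (fun y => u y (i + 2)) x - pd (i + 2) (fun y => u y (i + 1)) x := by
  fin_cases i <;> rfl

theorem cross_eq_sub (A B : Fin 3 → ℝ) (i : Fin 3) :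
    cross A B i = A (i + 1) * B (i + 2) - A (i + 2) * B (i + 1) := by
  fin_cases i <;> rfl

section ResidualStress

variable {Ω : Set E3} {κ : ℝ} {t : Fin 3 → Fin 3 → E3 → ℝ} {lam mu rho : E3 → ℝ}
  {u : E3 → Fin 3 → ℝ} {x : E3}

theorem ContDiffOn.divg (hΩ : IsOpen Ω) (hu : ∀ i, ContDiffOn ℝ (⊤ : ℕ∞) (fun x => u x i) Ω) :
    ContDiffOn ℝ (⊤ : ℕ∞) (divg u) Ω :=
  ContDiffOn.sum fun i _ => (hu i).pd hΩ i

theorem pd_divg (hΩ : IsOpen Ω) (hu : ∀ i, ContDiffOn ℝ (⊤ : ℕ∞) (fun x => u x i) Ω)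
    (hx : x ∈ Ω) (m : Fin 3) : pd m (divg u) x = ∑ i, pd i (pd m fun y => u y i) x := by
  unfold _root_.divg
  rw [pd_sum _ _ fun i => ((hu i).pd hΩ i).differentiableAt_of_isOpen hΩ hx]
  exact sum_congr rfl fun i _ => pd_comm hΩ (hu i) hx m i

theorem ResSystem.Rop_add_lowerTerms (hΩ : IsOpen Ω)
    (htsym : ∀ j k : Fin 3, ∀ x ∈ Ω, t j k x = t k j x)
    (hdivT : ∀ x ∈ Ω, ∀ i : Fin 3, (∑ j, pd j (t i j) x) = 0)
    (ht : ∀ j k, ContDiffOn ℝ (⊤ : ℕ∞) (t j k) Ω) (hlam : ContDiffOn ℝ (⊤ : ℕ∞) lam Ω)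
    (hmu : ContDiffOn ℝ (⊤ : ℕ∞) mu Ω)
    (hu : ∀ i, ContDiffOn ℝ (⊤ : ℕ∞) (fun x => u x i) Ω)
    (h : ResSystem t lam mu rho κ u Ω) (hx : x ∈ Ω) (i : Fin 3) :
    Rop (a1coef t mu) (fun y => u y i) x + lowerTerms lam mu rho κ u (divg u) i x = 0 := by
  have dt j k := (ht j k).differentiableAt_of_isOpen hΩ hx
  have dlam := hlam.differentiableAt_of_isOpen hΩ hx
  have dmu := hmu.differentiableAt_of_isOpen hΩ hx
  have dv := (ContDiffOn.divg hΩ hu).differentiableAt_of_isOpen hΩ hx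
  have du i k := ((hu i).pd hΩ k).differentiableAt_of_isOpen hΩ hx
  have hs (j : Fin 3) : pd j (fun y => stress t lam mu u y i j) x
      = pd j (t i j) x
        + (∑ k, (pd j (pd k fun y => u y i) x * t k j x + pd k (fun y => u y i) x * pd j (t k j) x))
        + (if i = j then 1 else 0) * (pd j lam x * divg u x + lam x * pd j (divg u) x)
        + (pd j mu x * (pd j (fun y => u y i) x + pd i (fun y => u y j) x)
          + mu x * (pd j (pd j fun y => u y i) x + pd j (pd i fun y => u y j) x)) := by
    have : (fun y => stress t lam mu u y i j) = fun y => t i j y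
        + (∑ k, pd k (fun y => u y i) y * t k j y)
        + (if i = j then 1 else 0) * (lam y * divg u y)
        + mu y * (pd j (fun y => u y i) y + pd i (fun y => u y j) y) := by
      funext y
      simp only [stress, strain]
      ring
    have dk k : DifferentiableAt ℝ (fun y => pd k (fun y => u y i) y * t k j y) x :=
      (du i k).fun_mul (dt k j)
    have dsum : DifferentiableAt ℝ (fun y => ∑ k, pd k (fun y => u y i) y * t k j y) x :=
      DifferentiableAt.fun_sum fun k _ => dk k
    have dlv := dlam.fun_mul dv
    have dE := (du i j).fun_add (du j i)
    rw [this, pd_add _ (((dt i j).fun_add dsum).fun_add (dlv.const_mul _)) (dmu.fun_mul dE),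
      pd_add _ ((dt i j).fun_add dsum) (dlv.const_mul _), pd_add _ (dt i j) dsum,
      pd_sum _ _ dk, pd_const_mul _ _ dlv, pd_mul _ dlam dv, pd_mul _ dmu dE,
      pd_add _ (du i j) (du j i)]
    simp only [pd_mul _ (du i _) (dt _ _)]
  have heq := h x hx i
  have h0 := hdivT x hx 0
  have h1 := hdivT x hx 1
  have h2 := hdivT x hx 2
  have hi := hdivT x hx i
  have hv := pd_divg hΩ hu hx i
  simp only [hs] at heq
  rw [Rop_a1coef]
  simp only [lowerTerms, Rop, lap, Fin.sum_univ_three] at *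
  rw [htsym 1 0 x hx, htsym 2 0 x hx, htsym 2 1 x hx] at *
  have hδ : (if i = 0 then 1 else 0) * (pd 0 lam x * divg u x + lam x * pd 0 (divg u) x)
      + (if i = 1 then 1 else 0) * (pd 1 lam x * divg u x + lam x * pd 1 (divg u) x)
      + (if i = 2 then 1 else 0) * (pd 2 lam x * divg u x + lam x * pd 2 (divg u) x)
      = pd i lam x * divg u x + lam x * pd i (divg u) x := by
    fin_cases i <;> simp
  linear_combination heq - hi - hδ - pd 0 (fun y => u y i) x * h0 - pd 1 (fun y => u y i) x * h1
    - pd 2 (fun y => u y i) x * h2 + mu x * hv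

theorem pd_lowerTerms (hΩ : IsOpen Ω) (hlam : ContDiffOn ℝ (⊤ : ℕ∞) lam Ω)
    (hmu : ContDiffOn ℝ (⊤ : ℕ∞) mu Ω) (hrho : ContDiffOn ℝ (⊤ : ℕ∞) rho Ω)
    (hu : ∀ i, ContDiffOn ℝ (⊤ : ℕ∞) (fun x => u x i) Ω) (hx : x ∈ Ω) (m i : Fin 3) :
    pd m (lowerTerms lam mu rho κ u (divg u) i) x =
      (pd m lam x + pd m mu x) * pd i (divg u) x + (lam x + mu x) * pd m (pd i (divg u)) x
        + (pd m (pd i lam) x * divg u x + pd i lam x * pd m (divg u) x)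
        + (∑ j, (pd m (pd j mu) x * (pd j (fun y => u y i) x + pd i (fun y => u y j) x)
          + pd j mu x * (pd m (pd j fun y => u y i) x + pd m (pd i fun y => u y j) x)))
        + κ ^ 2 * (pd m rho x * u x i + rho x * pd m (fun y => u y i) x) := by
  have hdiv := ContDiffOn.divg hΩ hu
  have dlam := hlam.differentiableAt_of_isOpen hΩ hx
  have dmu := hmu.differentiableAt_of_isOpen hΩ hx
  have drho := hrho.differentiableAt_of_isOpen hΩ hx
  have dlam' := (hlam.pd hΩ i).differentiableAt_of_isOpen hΩ hx
  have dmu' j := (hmu.pd hΩ j).differentiableAt_of_isOpen hΩ hx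
  have dv := hdiv.differentiableAt_of_isOpen hΩ hx
  have dv' := (hdiv.pd hΩ i).differentiableAt_of_isOpen hΩ hx
  have du := (hu i).differentiableAt_of_isOpen hΩ hx
  have du' i k := ((hu i).pd hΩ k).differentiableAt_of_isOpen hΩ hx
  have dE j := (du' i j).fun_add (du' j i)
  have dA := (dlam.fun_add dmu).fun_mul dv'
  have dB := dlam'.fun_mul dv
  have dC j := (dmu' j).fun_mul (dE j)
  have dsum := DifferentiableAt.fun_sum (u := univ) fun j _ => dC j
  have dD := drho.fun_mul du
  unfold lowerTerms
  rw [pd_add _ ((dA.fun_add dB).fun_add dsum) (dD.const_mul _), pd_add _ (dA.fun_add dB) dsum,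
    pd_add _ dA dB, pd_mul _ (dlam.fun_add dmu) dv', pd_add _ dlam dmu, pd_mul _ dlam' dv,
    pd_sum _ _ dC, pd_const_mul _ _ dD, pd_mul _ drho du]
  simp only [pd_mul _ (dmu' _) (dE _), pd_add _ (du' i _) (du' _ i)]

theorem ResSystem.pd_Rop_add_lowerTerms (hΩ : IsOpen Ω)
    (htsym : ∀ j k : Fin 3, ∀ x ∈ Ω, t j k x = t k j x)
    (hdivT : ∀ x ∈ Ω, ∀ i : Fin 3, (∑ j, pd j (t i j) x) = 0)
    (ht : ∀ j k, ContDiffOn ℝ (⊤ : ℕ∞) (t j k) Ω) (hlam : ContDiffOn ℝ (⊤ : ℕ∞) lam Ω)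
    (hmu : ContDiffOn ℝ (⊤ : ℕ∞) mu Ω)
    (hu : ∀ i, ContDiffOn ℝ (⊤ : ℕ∞) (fun x => u x i) Ω)
    (h : ResSystem t lam mu rho κ u Ω) (hx : x ∈ Ω) (m i : Fin 3) :
    Rop (a1coef t mu) (pd m fun y => u y i) x
      + (∑ j, ∑ k, pd m (t j k) x * pd j (pd k fun y => u y i) x)
      + pd m mu x * lap (fun y => u y i) x + pd m (lowerTerms lam mu rho κ u (divg u) i) x = 0 := by
  have ha := fun j k => ContDiffOn.a1coef ht hmu j k
  have hR : ContDiffOn ℝ (⊤ : ℕ∞) (Rop (a1coef t mu) fun y => u y i) Ω :=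
    ContDiffOn.sum fun j _ => ContDiffOn.sum fun k _ => (ha j k).mul (((hu i).pd hΩ k).pd hΩ j)
  have hF : ContDiffOn ℝ (⊤ : ℕ∞) (lowerTerms lam mu rho κ u (divg u) i) Ω :=
    hR.neg.congr fun y hy => by
      linarith [h.Rop_add_lowerTerms hΩ htsym hdivT ht hlam hmu hu hy i]
  have h0 : pd m (fun y => Rop (a1coef t mu) (fun y => u y i) y
      + lowerTerms lam mu rho κ u (divg u) i y) x = 0 := by
    rw [pd_congr (g := fun _ => 0) hΩ
      (fun y hy => h.Rop_add_lowerTerms hΩ htsym hdivT ht hlam hmu hu hy i) hx]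
    simp [pd]
  rw [pd_add _ (hR.differentiableAt_of_isOpen hΩ hx) (hF.differentiableAt_of_isOpen hΩ hx),
    pd_Rop hΩ ha (hu i) hx, Rop_a1coef] at h0
  have hm : Rop (fun j k => pd m (a1coef t mu j k)) (fun y => u y i) x
      = Rop (fun j k => pd m (t j k)) (fun y => u y i) x + pd m mu x * lap (fun y => u y i) x := by
    rw [← Rop_a1coef]
    simp only [Rop, pd_a1coef hΩ ht hmu hx]
  rw [hm] at h0
  change _ + Rop (fun j k => pd m (t j k)) (fun y => u y i) x + _ + _ = 0
  linarith [Rop_a1coef t mu (pd m fun y => u y i) x]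

theorem pd_curl (hΩ : IsOpen Ω) (hu : ∀ i, ContDiffOn ℝ (⊤ : ℕ∞) (fun x => u x i) Ω)
    (hx : x ∈ Ω) (m i : Fin 3) :
    pd m (fun y => curl u y i) x
      = pd m (pd (i + 1) fun y => u y (i + 2)) x - pd m (pd (i + 2) fun y => u y (i + 1)) x := by
  simp only [curl_apply]
  exact pd_sub _ (((hu _).pd hΩ _).differentiableAt_of_isOpen hΩ hx)
    (((hu _).pd hΩ _).differentiableAt_of_isOpen hΩ hx)

theorem lap_eq_pd_divg_sub_curl_curl (hΩ : IsOpen Ω)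
    (hu : ∀ i, ContDiffOn ℝ (⊤ : ℕ∞) (fun x => u x i) Ω) (hx : x ∈ Ω) (i : Fin 3) :
    lap (fun y => u y i) x = pd i (divg u) x - curl (curl u) x i := by
  rw [curl_apply, pd_curl hΩ hu hx, pd_curl hΩ hu hx, pd_divg hΩ hu hx, lap]
  simp only [Fin.sum_univ_three]
  fin_cases i <;> simp <;> ring

theorem ResSystem.divg_eq (hΩ : IsOpen Ω)
    (htsym : ∀ j k : Fin 3, ∀ x ∈ Ω, t j k x = t k j x)
    (hdivT : ∀ x ∈ Ω, ∀ i : Fin 3, (∑ j, pd j (t i j) x) = 0)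
    (ht : ∀ j k, ContDiffOn ℝ (⊤ : ℕ∞) (t j k) Ω) (hlam : ContDiffOn ℝ (⊤ : ℕ∞) lam Ω)
    (hmu : ContDiffOn ℝ (⊤ : ℕ∞) mu Ω) (hrho : ContDiffOn ℝ (⊤ : ℕ∞) rho Ω)
    (hu : ∀ i, ContDiffOn ℝ (⊤ : ℕ∞) (fun x => u x i) Ω)
    (h : ResSystem t lam mu rho κ u Ω) (hx : x ∈ Ω) :
    Rop t (divg u) x + (lam x + 2 * mu x) * lap (divg u) x
      = -(∑ j, ∑ k, ∑ m, pd m (t j k) x * pd j (pd k (fun y => u y m)) x)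
        + -divLowerTerms lam mu rho κ u (divg u) (curl u) x := by
  have hD i := h.pd_Rop_add_lowerTerms hΩ htsym hdivT ht hlam hmu hu hx i i
  have hR : Rop t (divg u) x + mu x * lap (divg u) x
      = ∑ i, Rop (a1coef t mu) (pd i fun y => u y i) x := by
    rw [← Rop_a1coef]
    exact Rop_sum hΩ _ _ (fun i => (hu i).pd hΩ i) hx
  have hv := pd_divg hΩ hu hx
  have hl := lap_eq_pd_divg_sub_curl_curl hΩ hu hx
  unfold divLowerTerms
  simp only [← hl]
  simp only [pd_lowerTerms hΩ hlam hmu hrho hu hx] at hD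
  have hD0 := hD 0
  have hD1 := hD 1
  have hD2 := hD 2
  have hd : divg u x = ∑ i, pd i (fun y => u y i) x := rfl
  have hv0 := hv 0
  have hv1 := hv 1
  have hv2 := hv 2
  simp only [lap, Fin.sum_univ_three] at *
  linear_combination hR + hD0 + hD1 + hD2 + pd 0 mu x * hv0 + pd 1 mu x * hv1
    + pd 2 mu x * hv2 + κ ^ 2 * rho x * hd

theorem ResSystem.curl_eq (hΩ : IsOpen Ω)
    (htsym : ∀ j k : Fin 3, ∀ x ∈ Ω, t j k x = t k j x)
    (hdivT : ∀ x ∈ Ω, ∀ i : Fin 3, (∑ j, pd j (t i j) x) = 0)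
    (ht : ∀ j k, ContDiffOn ℝ (⊤ : ℕ∞) (t j k) Ω) (hlam : ContDiffOn ℝ (⊤ : ℕ∞) lam Ω)
    (hmu : ContDiffOn ℝ (⊤ : ℕ∞) mu Ω) (hrho : ContDiffOn ℝ (⊤ : ℕ∞) rho Ω)
    (hu : ∀ i, ContDiffOn ℝ (⊤ : ℕ∞) (fun x => u x i) Ω)
    (h : ResSystem t lam mu rho κ u Ω) (hx : x ∈ Ω) (i : Fin 3) :
    Rop t (fun y => curl u y i) x + mu x * lap (fun y => curl u y i) x
      = -(∑ j, ∑ k, cross (fun m => pd m (t j k) x)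
            (fun m => pd j (pd k (fun y => u y m)) x) i)
        + -curlLowerTerms mu rho κ u (divg u) (curl u) i x := by
  have hD m i := h.pd_Rop_add_lowerTerms hΩ htsym hdivT ht hlam hmu hu hx m i
  have hR : Rop t (fun y => curl u y i) x + mu x * lap (fun y => curl u y i) x
      = Rop (a1coef t mu) (pd (i + 1) fun y => u y (i + 2)) x
        - Rop (a1coef t mu) (pd (i + 2) fun y => u y (i + 1)) x := by
    rw [← Rop_a1coef]
    simp only [curl_apply]
    exact Rop_sub hΩ _ ((hu _).pd hΩ _) ((hu _).pd hΩ _) hx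
  have hl := lap_eq_pd_divg_sub_curl_curl hΩ hu hx
  have hc j k l := pd_comm hΩ (hu l) hx j k
  have hcv := pd_comm hΩ (ContDiffOn.divg hΩ hu) hx (i + 1) (i + 2)
  have hcl := pd_comm hΩ hlam hx (i + 1) (i + 2)
  have hw := curl_apply u x i
  have hD1 := hD (i + 1) (i + 2)
  have hD2 := hD (i + 2) (i + 1)
  simp only [cross_eq_sub, sum_sub_distrib]
  unfold curlLowerTerms
  simp only [← hl, pd_curl hΩ hu hx _ i]
  simp only [pd_lowerTerms hΩ hlam hmu hrho hu hx] at hD1 hD2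
  simp only [Fin.sum_univ_three] at *
  linear_combination hR + hD1 - hD2 - (lam x + mu x) * hcv - divg u x * hcl
    + κ ^ 2 * rho x * hw + pd 0 mu x * (hc 0 (i + 1) (i + 2) - hc 0 (i + 2) (i + 1)
      - hc (i + 1) (i + 2) 0)
    + pd 1 mu x * (hc 1 (i + 1) (i + 2) - hc 1 (i + 2) (i + 1) - hc (i + 1) (i + 2) 1)
    + pd 2 mu x * (hc 2 (i + 1) (i + 2) - hc 2 (i + 2) (i + 1) - hc (i + 1) (i + 2) 2)

end ResidualStress

section FirstOrder

variable {Ω : Set E3} {lam mu rho : E3 → ℝ} {n : ℕ}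

theorem isFirstOrderOn_lowerTerms (κ : ℝ) (hΩ : IsOpen Ω)
    (hlam : ContDiffOn ℝ (⊤ : ℕ∞) lam Ω) (hmu : ContDiffOn ℝ (⊤ : ℕ∞) mu Ω)
    (hrho : ContDiffOn ℝ (⊤ : ℕ∞) rho Ω) (σ : Fin 3 → Fin n) (s : Fin n) (i : Fin 3) :
    IsFirstOrderOn Ω (fun U x =>
      lowerTerms lam mu rho κ (fun y k => U y (σ k)) (fun y => U y s) i x) := by
  have hmu' := hmu.pd hΩ
  exact (((IsFirstOrderOn.pd s i).mul (hlam.add hmu)).add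
      ((IsFirstOrderOn.apply s).mul (hlam.pd hΩ i))).add
    (.sum _ fun j => ((IsFirstOrderOn.pd _ _).add (.pd _ _)).mul (hmu' j)) |>.add
    (((IsFirstOrderOn.apply _).mul hrho).mul contDiffOn_const)

theorem isFirstOrderOn_divLowerTerms (κ : ℝ) (hΩ : IsOpen Ω)
    (hlam : ContDiffOn ℝ (⊤ : ℕ∞) lam Ω) (hmu : ContDiffOn ℝ (⊤ : ℕ∞) mu Ω)
    (hrho : ContDiffOn ℝ (⊤ : ℕ∞) rho Ω) (σ : Fin 3 → Fin n) (s : Fin n) (τ : Fin 3 → Fin n) :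
    IsFirstOrderOn Ω (fun U x => divLowerTerms lam mu rho κ (fun y k => U y (σ k))
      (fun y => U y s) (fun y k => U y (τ k)) x) := by
  have hlam' := hlam.pd hΩ
  have hmu' := hmu.pd hΩ
  refine .add (.sum _ fun i => .add (.add (.add (.add ?_ ?_) ?_) (.sum _ fun j => ?_)) ?_) ?_
  · exact .mul (contDiffOn_const.mul (hmu' i)) (.sub (.pd _ _) (.curl _ _))
  · exact .mul ((contDiffOn_const.mul (hlam' i)).add (contDiffOn_const.mul (hmu' i))) (.pd _ _)
  · exact .mul ((hlam' i).pd hΩ i) (.apply _)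
  · exact .mul ((hmu' j).pd hΩ i) (.add (.pd _ _) (.pd _ _))
  · exact .mul (contDiffOn_const.mul (hrho.pd hΩ i)) (.apply _)
  · exact .mul (contDiffOn_const.mul hrho) (.apply _)

theorem isFirstOrderOn_curlLowerTerms (κ : ℝ) (hΩ : IsOpen Ω)
    (hmu : ContDiffOn ℝ (⊤ : ℕ∞) mu Ω) (hrho : ContDiffOn ℝ (⊤ : ℕ∞) rho Ω)
    (σ : Fin 3 → Fin n) (s : Fin n) (τ : Fin 3 → Fin n)
    (i : Fin 3) :
    IsFirstOrderOn Ω (fun U x => curlLowerTerms mu rho κ (fun y k => U y (σ k))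
      (fun y => U y s) (fun y k => U y (τ k)) i x) := by
  have hmu' := hmu.pd hΩ
  refine .add (.sub (.add (.add (.sub (.add (.sub ?_ ?_) ?_) ?_) (.sum _ fun j => ?_)) ?_) ?_) ?_
  · exact .mul (hmu' _) (.sub (.pd _ _) (.curl _ _))
  · exact .mul (hmu' _) (.sub (.pd _ _) (.curl _ _))
  · exact .mul (hmu' _) (.pd _ _)
  · exact .mul (hmu' _) (.pd _ _)
  · exact .add (.sub (.mul ((hmu' j).pd hΩ _) (.add (.pd _ _) (.pd _ _)))
      (.mul ((hmu' j).pd hΩ _) (.add (.pd _ _) (.pd _ _)))) (.mul (hmu' j) (.pd _ _))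
  · exact .mul (contDiffOn_const.mul (hrho.pd hΩ _)) (.apply _)
  · exact .mul (contDiffOn_const.mul (hrho.pd hΩ _)) (.apply _)
  · exact .mul (contDiffOn_const.mul hrho) (.apply _)

end FirstOrder

/-- **Reduction to a second-order system** (equations (2.2)–(2.4)).  Let
`R = Σ t_jk ∂²_{jk}`, `P₁ = R + μΔ`, `P₂ = R + (λ+2μ)Δ`.  For every smooth
solution `u` of the residual stress system, with `v = ∇·u`, `w = ∇×u`, there
are smooth coefficients (independent of `u`) such that
`P₁u = Σ_{|β|≤1} c¹_β ∂^β(u,v)`,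
`P₂v = -Σ ∇t_jk · ∂²_{jk}u + Σ_{|β|≤1} c²_β ∂^β(u,v,w)`, and
`P₁w = -Σ ∇t_jk × ∂²_{jk}u + Σ_{|β|≤1} c³_β ∂^β(u,v,w)` in `Ω`. -/
theorem reduction_to_second_order_system
    (Ω : Set E3) (hΩopen : IsOpen Ω)
    (κ : ℝ) (t : Fin 3 → Fin 3 → E3 → ℝ) (lam mu rho : E3 → ℝ)
    (htsym : ∀ j k : Fin 3, ∀ x ∈ Ω, t j k x = t k j x)
    (hdivT : ∀ x ∈ Ω, ∀ i : Fin 3, (∑ j, pd j (t i j) x) = 0)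
    (hrho : ∀ x ∈ Ω, 0 < rho x)
    (hsmooth : (∀ j k : Fin 3, ContDiffOn ℝ (⊤ : ℕ∞) (t j k) Ω) ∧ ContDiffOn ℝ (⊤ : ℕ∞) lam Ω ∧
      ContDiffOn ℝ (⊤ : ℕ∞) mu Ω ∧ ContDiffOn ℝ (⊤ : ℕ∞) rho Ω) :
    ∃ c1 : (Fin 3 → ℕ) → E3 → Fin 3 → Fin 4 → ℝ,
      ∃ c2 : (Fin 3 → ℕ) → E3 → Fin 7 → ℝ,
        ∃ c3 : (Fin 3 → ℕ) → E3 → Fin 3 → Fin 7 → ℝ,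
      (∀ β : Fin 3 → ℕ, mdeg β ≤ 1 →
        (∀ i j, ContDiffOn ℝ (⊤ : ℕ∞) (fun x => c1 β x i j) Ω) ∧
        (∀ j, ContDiffOn ℝ (⊤ : ℕ∞) (fun x => c2 β x j) Ω) ∧
        (∀ i j, ContDiffOn ℝ (⊤ : ℕ∞) (fun x => c3 β x i j) Ω)) ∧
      ∀ u : E3 → Fin 3 → ℝ, (∀ i : Fin 3, ContDiffOn ℝ (⊤ : ℕ∞) (fun x => u x i) Ω) →
        ResSystem t lam mu rho κ u Ω →
        ∀ x ∈ Ω,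
          (∀ i : Fin 3,
            Rop t (fun y => u y i) x + mu x * lap (fun y => u y i) x
              = ∑ β ∈ Finset.univ.filter
                    (fun β : Fin 3 → Fin 2 => mdeg (fun k => (β k : ℕ)) ≤ 1),
                  ∑ j, c1 (fun k => (β k : ℕ)) x i j
                    * mpd (fun k => (β k : ℕ)) (fun y => uvPair u y j) x) ∧
          (Rop t (divg u) x + (lam x + 2 * mu x) * lap (divg u) x
            = -(∑ j, ∑ k, ∑ m, pd m (t j k) x * pd j (pd k (fun y => u y m)) x)
              + ∑ β ∈ Finset.univ.filter
                    (fun β : Fin 3 → Fin 2 => mdeg (fun k => (β k : ℕ)) ≤ 1),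
                  ∑ j, c2 (fun k => (β k : ℕ)) x j
                    * mpd (fun k => (β k : ℕ)) (fun y => Ufull u y j) x) ∧
          (∀ i : Fin 3,
            Rop t (fun y => curl u y i) x + mu x * lap (fun y => curl u y i) x
              = -(∑ j, ∑ k, cross (fun m => pd m (t j k) x)
                    (fun m => pd j (pd k (fun y => u y m)) x) i)
                + ∑ β ∈ Finset.univ.filter
                      (fun β : Fin 3 → Fin 2 => mdeg (fun k => (β k : ℕ)) ≤ 1),
                    ∑ j, c3 (fun k => (β k : ℕ)) x i j
                      * mpd (fun k => (β k : ℕ)) (fun y => Ufull u y j) x) := by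
  obtain ⟨ht, hlam, hmu, hrho'⟩ := hsmooth
  choose c1 hc1 hL1 using fun i =>
    (isFirstOrderOn_lowerTerms κ hΩopen hlam hmu hrho' ![0, 1, 2] (3 : Fin 4) i).neg
  obtain ⟨c2, hc2, hL2⟩ :=
    (isFirstOrderOn_divLowerTerms κ hΩopen hlam hmu hrho' ![0, 1, 2] (3 : Fin 7) ![4, 5, 6]).neg
  choose c3 hc3 hL3 using fun i =>
    (isFirstOrderOn_curlLowerTerms κ hΩopen hmu hrho' ![0, 1, 2] (3 : Fin 7) ![4, 5, 6] i).neg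
  refine ⟨fun β x i j => c1 i β x j, c2, fun β x i j => c3 i β x j,
    fun β _ => ⟨fun i j => hc1 i β j, fun j => hc2 β j, fun i j => hc3 i β j⟩,
    fun u hu h x hx => ⟨fun i => ?_, ?_, fun i => ?_⟩⟩
  · have hu4 : (fun y k => uvPair u y (![0, 1, 2] k)) = u := by
      funext y k
      fin_cases k <;> rfl
    rw [← hL1 i (uvPair u) x hx]
    beta_reduce
    rw [hu4]
    linarith [Rop_a1coef t mu (fun y => u y i) x,
      h.Rop_add_lowerTerms hΩopen htsym hdivT ht hlam hmu hu hx i,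
      show lowerTerms lam mu rho κ u (fun y => uvPair u y 3) i x
        = lowerTerms lam mu rho κ u (divg u) i x from rfl]
  all_goals
    have hu7 : (fun y k => Ufull u y (![0, 1, 2] k)) = u := by
      funext y k
      fin_cases k <;> rfl
    have hw7 : (fun y k => Ufull u y (![4, 5, 6] k)) = curl u := by
      funext y k
      fin_cases k <;> rfl
  · rw [← hL2 (Ufull u) x hx]
    beta_reduce
    rw [hu7, hw7]
    exact h.divg_eq hΩopen htsym hdivT ht hlam hmu hrho' hu hx
  · rw [← hL3 i (Ufull u) x hx]
    beta_reduce
    rw [hu7, hw7]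
    exact h.curl_eq hΩopen htsym hdivT ht hlam hmu hrho' hu hx i
end
end
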